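/- arXiv:math/0404013 — 4 statements merged into one kernel-verified Lean document; each statement's English description precedes it below -/
import Mathlib

section
/- Fix m ∈ ℕ with m ≥ 3, let f ∈ F_m(ℂ) and set v(z) = Im f(z). Then there exist reals c_{k,ℓ} (k, ℓ ∈ ℕ) such that for every (x, y) ∈ ℝ² the family (c_{k,ℓ} x^k y^ℓ)_{(k,ℓ)∈ℕ×ℕ} is absolutely summable and v(x + iy) = Σ_{(k,ℓ)∈ℕ×ℕ} c_{k,ℓ} x^k y^ℓ. -/
open ComplexConjugate
open scoped ComplexOrder

/-- `FmC m f` : the class `F_m(ℂ)` of functions `f : ℂ → ℂ` such that for every `n` and every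
`n × n` complex Hermitian positive semidefinite matrix `A` of rank at most `m`, the entrywise
image matrix `(f (A r s))` is Hermitian positive semidefinite. -/
def FmC (m : ℕ) (f : ℂ → ℂ) : Prop :=
  ∀ (n : ℕ) (A : Matrix (Fin n) (Fin n) ℂ),
    A.PosSemidef → A.rank ≤ m → (A.map f).PosSemidef

section

open Finset Filter Topology

/-- Entrywise application of `g` to the Gram matrix of any finite family in `ℂ^d` gives a
nonnegative Hermitian form. -/
def GramPos (d : ℕ) (g : ℂ → ℂ) : Prop :=
  ∀ (ι : Type) [Fintype ι] (x : ι → Fin d → ℂ) (v : ι → ℂ),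
    0 ≤ ∑ r, ∑ s, conj (v r) * v s * g (∑ k, x r k * conj (x s k))

theorem FmC.posSemidef_gram {m : ℕ} (hm : 3 ≤ m) {f : ℂ → ℂ} (hf : FmC m f)
    {ι : Type} [Fintype ι] (x : ι → Fin 3 → ℂ) :
    (Matrix.of fun r s => f (∑ k, x r k * conj (x s k))).PosSemidef := by
  let e := Fintype.equivFin ι
  let B : Matrix (Fin (Fintype.card ι)) (Fin 3) ℂ := Matrix.of fun i k => x (e.symm i) k
  have h := hf _ (B * B.conjTranspose) (Matrix.posSemidef_self_mul_conjTranspose B)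
    (((Matrix.rank_mul_le_left _ _).trans (Matrix.rank_le_width _)).trans hm)
  convert h.submatrix e
  ext r s
  simp [B, Matrix.mul_apply]

theorem FmC.gramPos {m : ℕ} (hm : 3 ≤ m) {f : ℂ → ℂ} (hf : FmC m f) : GramPos 3 f := by
  intro ι _ x v
  have h := (hf.posSemidef_gram hm x).dotProduct_mulVec_nonneg v
  simpa [dotProduct, Matrix.mulVec, mul_sum, mul_assoc, mul_comm, mul_left_comm] using h

theorem Matrix.PosSemidef.norm_sq_le {ι : Type} [Fintype ι] {M : Matrix ι ι ℂ}
    (hM : M.PosSemidef) (u v : ι → ℂ) :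
    ‖star u ⬝ᵥ M.mulVec v‖ ^ 2 ≤ (star u ⬝ᵥ M.mulVec u).re * (star v ⬝ᵥ M.mulVec v).re := by
  let C : Matrix ι (Fin 2) ℂ := Matrix.of fun i k => ![u i, v i] k
  have hC := hM.conjTranspose_mul_mul_same C
  have hd := hC.det_nonneg
  have hh : ∀ i j, (C.conjTranspose * M * C) i j =
      star (fun r => C r i) ⬝ᵥ M.mulVec (fun r => C r j) := by
    intro i j
    simp only [Matrix.mul_apply, dotProduct, Matrix.mulVec, sum_mul, mul_sum]
    rw [sum_comm]
    simp [mul_assoc]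
  have h00 := hh 0 0
  have h01 := hh 0 1
  have h11 := hh 1 1
  have h10 : (C.conjTranspose * M * C) 1 0 = conj ((C.conjTranspose * M * C) 0 1) :=
    (hC.1.apply 1 0).symm
  have d0 : 0 ≤ (C.conjTranspose * M * C) 0 0 := hC.diag_nonneg
  have d1 : 0 ≤ (C.conjTranspose * M * C) 1 1 := hC.diag_nonneg
  have e0 := Complex.eq_re_of_ofReal_le (r := 0) (by simpa using d0)
  have e1 := Complex.eq_re_of_ofReal_le (r := 0) (by simpa using d1)
  rw [Matrix.det_fin_two, h10, Complex.mul_conj, e0, e1, ← Complex.ofReal_mul,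
    ← Complex.ofReal_sub, Complex.zero_le_real, sub_nonneg, Complex.normSq_eq_norm_sq, h01, h00,
    h11] at hd
  simpa [C] using hd

theorem GramPos.nonneg {d : ℕ} {g : ℂ → ℂ} (hg : GramPos (d + 1) g) {r : ℝ} (hr : 0 ≤ r) :
    0 ≤ g r := by
  have h := hg Unit (fun _ => Fin.cons (√r : ℂ) 0) (fun _ => 1)
  simpa [Fin.sum_univ_succ, ← Complex.ofReal_mul, Real.mul_self_sqrt hr] using h

theorem GramPos.comp_const_add {d : ℕ} {g : ℂ → ℂ} (hg : GramPos (d + 1) g) {a : ℝ}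
    (ha : 0 ≤ a) : GramPos d (fun z => g (a + z)) := by
  intro ι _ x v
  have h := hg ι (fun r => Fin.cons (√a : ℂ) (x r)) v
  simpa [Fin.sum_univ_succ, ← Complex.ofReal_mul, Real.mul_self_sqrt ha] using h

theorem FmC.norm_le {m : ℕ} (hm : 3 ≤ m) {f : ℂ → ℂ} (hf : FmC m f) {z : ℂ} {r : ℝ}
    (hz : ‖z‖ ≤ r) : ‖f z‖ ≤ (f r).re := by
  have hr0 : 0 ≤ r := (norm_nonneg z).trans hz
  rcases hr0.eq_or_lt with rfl | hr
  · obtain rfl : z = 0 := by simpa using hz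
    have h := (hf.gramPos hm).nonneg le_rfl
    have h2 := Complex.eq_re_of_ofReal_le (r := 0) (by simpa using h)
    simp only [Complex.ofReal_zero] at h h2 ⊢
    conv_lhs => rw [h2]
    rw [Complex.norm_real, Real.norm_of_nonneg (Complex.nonneg_iff.1 h).1]
  set q : ℝ := √(r - ‖z‖ ^ 2 / r) with hq
  have hq2 : q * q = r - ‖z‖ ^ 2 / r := by
    apply Real.mul_self_sqrt
    rw [sub_nonneg, div_le_iff₀ hr]
    nlinarith [norm_nonneg z]
  have hs : √r * √r = r := Real.mul_self_sqrt hr0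
  have hsC : (√r : ℂ) * √r = r := by rw [← Complex.ofReal_mul, hs]
  have hs0 : (√r : ℂ) ≠ 0 := by
    simpa using (Real.sqrt_pos.2 hr).ne'
  have hM := hf.posSemidef_gram hm
    (![![(√r : ℂ), 0, 0], ![conj z / √r, q, 0]] : Fin 2 → Fin 3 → ℂ)
  have h := hM.norm_sq_le ![1, 0] ![0, 1]
  have e2 : z / √r * (conj z / √r) + q * q = r := by
    rw [div_mul_div_comm, hsC, Complex.mul_conj, Complex.normSq_eq_norm_sq]
    norm_cast
    rw [hq2]; ring
  have e2' : conj z / √r * (z / √r) + q * q = r := by rw [← e2]; ring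
  have e3 : √r * (z / √r) = z := by field_simp
  simp [dotProduct, Matrix.mulVec, Fin.sum_univ_three, e2', hsC, e3] at h
  have h0 : 0 ≤ (f r).re := (Complex.nonneg_iff.1 ((hf.gramPos hm).nonneg hr0)).1
  nlinarith [norm_nonneg (f z)]

theorem FmC.norm_sub_sq_le {m : ℕ} (hm : 3 ≤ m) {f : ℂ → ℂ} (hf : FmC m f) {z w : ℂ} {B : ℝ}
    (hzw : z ≠ w) (hB : ‖z - w‖ ^ 2 < B) :
    ‖f z - f w‖ ^ 2 ≤ (f ((‖z + w‖ ^ 2 / (4 * (B - ‖z - w‖ ^ 2)) + 1 / 4 : ℝ) : ℂ)).re *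
      (2 * ((f B).re - (f ((B - 2 * ‖z - w‖ ^ 2 : ℝ) : ℂ)).re)) := by
  set q : ℝ := ‖z - w‖ with hq
  have hq0 : 0 < q := norm_pos_iff.2 (sub_ne_zero.2 hzw)
  set p : ℝ := √(B - q ^ 2) with hp
  have hp2 : p * p = B - q ^ 2 := Real.mul_self_sqrt (by linarith)
  have hp0 : 0 < p := Real.sqrt_pos.2 (by linarith)
  have hpC : (p : ℂ) ≠ 0 := by exact_mod_cast hp0.ne'
  have hqC : (q : ℂ) ≠ 0 := by exact_mod_cast hq0.ne'
  have hM := hf.posSemidef_gram hm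
    (![![(z + w) / (2 * p), (z - w) / (2 * q), 0], ![(p : ℂ), q, 0], ![(p : ℂ), -q, 0]] :
      Fin 3 → Fin 3 → ℂ)
  have h := hM.norm_sq_le ![1, 0, 0] ![0, 1, -1]
  have e1 : (z + w) / (2 * p) * p + (z - w) / (2 * q) * q = z := by field_simp; ring
  have e2 : (z + w) / (2 * p) * p + -((z - w) / (2 * q) * q) = w := by field_simp; ring
  have e3 : (z + w) / (2 * p) * ((conj z + conj w) / (2 * p)) +
      (z - w) / (2 * q) * ((conj z - conj w) / (2 * q)) =
      ((‖z + w‖ ^ 2 / (4 * (B - q ^ 2)) + 1 / 4 : ℝ) : ℂ) := by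
    rw [div_mul_div_comm, div_mul_div_comm, ← map_add, ← map_sub, Complex.mul_conj,
      Complex.mul_conj, Complex.normSq_eq_norm_sq, Complex.normSq_eq_norm_sq, ← hq, ← hp2]
    push_cast
    field_simp
    ring
  have e4 : (p : ℂ) * p + q * q = B := by norm_cast; rw [hp2]; ring
  have e5 : (p : ℂ) * p + -(q * q) = ((B - 2 * q ^ 2 : ℝ) : ℂ) := by norm_cast; rw [hp2]; ring
  have hc2 : conj (2 : ℂ) = 2 := map_ofNat _ 2
  simp only [dotProduct, Pi.star_apply, RCLike.star_def, Matrix.mulVec, Matrix.of_apply,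
    Fin.sum_univ_three, Matrix.cons_val, map_div₀, map_add, map_sub, map_mul, hc2,
    Complex.conj_ofReal, map_zero, mul_zero, add_zero, map_one, one_mul, zero_mul, mul_one,
    map_neg, mul_neg, neg_mul, zero_add, neg_neg, e1, e2, e3, e4, e5, Complex.add_re,
    Complex.neg_re] at h
  refine le_trans (le_of_eq ?_) (h.trans (le_of_eq ?_))
  · rw [sub_eq_add_neg]
  · ring

theorem FmC.monotone_re {m : ℕ} (hm : 3 ≤ m) {f : ℂ → ℂ} (hf : FmC m f) :
    Monotone fun r : ℝ => (f ((max r 0 : ℝ) : ℂ)).re := by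
  intro r s hrs
  refine (Complex.re_le_norm _).trans (hf.norm_le hm ?_)
  rw [Complex.norm_real, Real.norm_of_nonneg (le_max_right _ _)]
  exact max_le_max_right 0 hrs

theorem FmC.continuous {m : ℕ} (hm : 3 ≤ m) {f : ℂ → ℂ} (hf : FmC m f) : Continuous f := by
  have hmono := hf.monotone_re hm
  obtain ⟨B, hB, hB0⟩ := (hmono.countable_not_continuousAt.dense_compl ℝ).exists_mem_open
    isOpen_Ioi (Set.nonempty_Ioi (a := (0 : ℝ)))
  simp only [Set.mem_compl_iff, Set.mem_ofPred_eq, not_not, Set.mem_Ioi] at hB hB0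
  set F := fun r : ℝ => (f ((max r 0 : ℝ) : ℂ)).re with hF
  have hFf : ∀ r : ℝ, 0 ≤ r → (f (r : ℂ)).re = F r := fun r hr => by simp [hF, max_eq_left hr]
  rw [continuous_iff_continuousAt]
  intro z
  have hsq : Tendsto (fun w => ‖w - z‖ ^ 2) (𝓝 z) (𝓝 0) := by
    have : Continuous fun w : ℂ => ‖w - z‖ ^ 2 := by fun_prop
    simpa using this.tendsto z
  have hlim : Tendsto (fun w => F ((‖z‖ + 1 + ‖z‖) ^ 2 / (4 * (B / 2)) + 1 / 4) *
      (2 * (F B - F (B - 2 * ‖w - z‖ ^ 2)))) (𝓝 z) (𝓝 0) := by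
    have h1 : Tendsto (fun w => B - 2 * ‖w - z‖ ^ 2) (𝓝 z) (𝓝 B) := by
      simpa using (hsq.const_mul 2).const_sub B
    have h2 := hB.tendsto.comp h1
    simpa using ((h2.const_sub (F B)).const_mul 2).const_mul
      (F ((‖z‖ + 1 + ‖z‖) ^ 2 / (4 * (B / 2)) + 1 / 4))
  have hev : ∀ᶠ w in 𝓝 z, ‖f w - f z‖ ^ 2 ≤
      F ((‖z‖ + 1 + ‖z‖) ^ 2 / (4 * (B / 2)) + 1 / 4) *
      (2 * (F B - F (B - 2 * ‖w - z‖ ^ 2))) := by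
    have h1 : ∀ᶠ w in 𝓝 z, ‖w - z‖ ^ 2 < min 1 (B / 2) :=
      hsq.eventually_lt_const (by positivity)
    filter_upwards [h1] with w hw
    rcases eq_or_ne w z with rfl | hwz
    · simp
    rw [lt_min_iff] at hw
    have h := hf.norm_sub_sq_le hm hwz (hw.2.trans (by linarith : B / 2 < B))
    have hpos : 0 ≤ B - 2 * ‖w - z‖ ^ 2 := by linarith
    have hnum : ‖w + z‖ ≤ ‖z‖ + 1 + ‖z‖ := by
      have h3 : ‖w - z‖ ≤ 1 := by nlinarith [norm_nonneg (w - z)]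
      have h4 : ‖w + z‖ ≤ ‖w - z‖ + ‖z + z‖ := by
        simpa using norm_add_le (w - z) (z + z)
      linarith [norm_add_le z z]
    have hden : 0 < B - ‖w - z‖ ^ 2 := by linarith
    rw [hFf _ (by positivity), hFf _ hB0.le, hFf _ hpos] at h
    refine h.trans (mul_le_mul_of_nonneg_right (hmono ?_) ?_)
    · gcongr
      linarith
    · have : F (B - 2 * ‖w - z‖ ^ 2) ≤ F B := hmono (by nlinarith [sq_nonneg ‖w - z‖])
      linarith
  have h0 : Tendsto (fun w => ‖f w - f z‖ ^ 2) (𝓝 z) (𝓝 0) :=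
    tendsto_of_tendsto_of_tendsto_of_le_of_le' tendsto_const_nhds hlim
      (Eventually.of_forall fun w => by positivity) hev
  rw [ContinuousAt, tendsto_iff_norm_sub_tendsto_zero]
  have := h0.sqrt
  simpa [Real.sqrt_sq] using this

open MeasureTheory AddCircle in
theorem integral_haarAddCircle_nonneg {ψ : UnitAddCircle → ℂ} (hψ : Continuous ψ)
    (h : ∀ N : ℕ, 0 ≤ ∑ k : ZMod (N + 1), ψ (ZMod.toAddCircle k)) :
    0 ≤ ∫ θ, ψ θ ∂haarAddCircle := by
  set φ : ℝ → ℂ := fun t => ψ t with hφ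
  have hφc : Continuous φ := hψ.comp (AddCircle.continuous_mk' 1)
  have hint : ∫ θ, ψ θ ∂haarAddCircle = ∫ t in (0 : ℝ)..1, φ t := by
    have h1 := fourierCoeff_eq_intervalIntegral ψ 0 0
    simpa [fourierCoeff] using h1
  rw [hint]
  have hsum : ∀ N : ℕ, ∑ k : ZMod (N + 1), ψ (ZMod.toAddCircle k) =
      ∑ k ∈ range (N + 1), φ (k / (N + 1 : ℕ)) := by
    intro N
    simp only [ZMod.toAddCircle_apply]
    exact Fin.sum_univ_eq_sum_range (fun k : ℕ => φ (k / (N + 1 : ℕ))) (N + 1)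
  have hlim : Tendsto (fun N : ℕ => ((N + 1 : ℕ) : ℂ)⁻¹ * ∑ k ∈ range (N + 1), φ (k / (N + 1 : ℕ)))
      atTop (𝓝 (∫ t in (0 : ℝ)..1, φ t)) := by
    rw [Metric.tendsto_atTop]
    intro ε hε
    have huc := (isCompact_Icc (a := (0 : ℝ)) (b := 1)).uniformContinuousOn_of_continuous
      hφc.continuousOn
    rw [Metric.uniformContinuousOn_iff] at huc
    obtain ⟨δ, hδ, hu⟩ := huc (ε / 2) (by positivity)
    obtain ⟨M, hM⟩ := exists_nat_one_div_lt hδ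
    refine ⟨M, fun N hN => ?_⟩
    have hN0 : (0 : ℝ) < (N + 1 : ℕ) := by positivity
    have hNδ : 1 / ((N + 1 : ℕ) : ℝ) < δ := by
      refine lt_of_le_of_lt ?_ hM
      push_cast
      gcongr
    have hsplit : ∑ k ∈ range (N + 1),
        ∫ t in ((k : ℕ) / (N + 1 : ℕ) : ℝ)..((k + 1 : ℕ) / (N + 1 : ℕ)), φ t
        = ∫ t in (0 : ℝ)..1, φ t := by
      rw [intervalIntegral.sum_integral_adjacent_intervals
        (a := fun k : ℕ => ((k : ℕ) / (N + 1 : ℕ) : ℝ))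
        (fun k _ => hφc.intervalIntegrable _ _)]
      rw [div_self hN0.ne']
      simp
    have hconst : ∀ k : ℕ, ((N + 1 : ℕ) : ℂ)⁻¹ * φ (k / (N + 1 : ℕ)) =
        ∫ t in ((k : ℕ) / (N + 1 : ℕ) : ℝ)..((k + 1 : ℕ) / (N + 1 : ℕ)), φ (k / (N + 1 : ℕ)) := by
      intro k
      rw [intervalIntegral.integral_const, ← sub_div]
      push_cast
      rw [add_sub_cancel_left, Complex.real_smul]
      push_cast
      ring
    rw [← hsplit, mul_sum, dist_eq_norm, ← sum_sub_distrib]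
    have hterm : ∀ k ∈ range (N + 1), ‖((N + 1 : ℕ) : ℂ)⁻¹ * φ (k / (N + 1 : ℕ)) -
        ∫ t in ((k : ℕ) / (N + 1 : ℕ) : ℝ)..((k + 1 : ℕ) / (N + 1 : ℕ)), φ t‖ ≤
        ε / 2 * (1 / (N + 1 : ℕ)) := by
      intro k hk
      have hle : ((k : ℕ) / (N + 1 : ℕ) : ℝ) ≤ (k + 1 : ℕ) / (N + 1 : ℕ) := by
        gcongr; simp
      have h1 : ((k + 1 : ℕ) / (N + 1 : ℕ) : ℝ) ≤ 1 := by
        rw [div_le_one hN0]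
        exact_mod_cast mem_range.1 hk
      have hw : ((k + 1 : ℕ) / (N + 1 : ℕ) : ℝ) - (k : ℕ) / (N + 1 : ℕ) = 1 / (N + 1 : ℕ) := by
        rw [← sub_div]; push_cast; ring
      have h0 : (0 : ℝ) ≤ (k : ℕ) / (N + 1 : ℕ) := by positivity
      rw [hconst, ← intervalIntegral.integral_sub (by simp) (hφc.intervalIntegrable _ _)]
      refine (intervalIntegral.norm_integral_le_of_norm_le_const (C := ε / 2) fun t ht => ?_).trans
        ?_
      · rw [Set.uIoc_of_le hle] at ht
        rw [← dist_eq_norm]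
        refine (hu _ ⟨h0, hle.trans h1⟩ _ ⟨h0.trans ht.1.le, ht.2.trans h1⟩ ?_).le
        rw [Real.dist_eq, abs_sub_comm, abs_of_nonneg (by linarith [ht.1])]
        linarith [ht.2]
      · rw [hw, abs_of_nonneg (by positivity)]
    refine (norm_sum_le_of_le _ hterm).trans_lt ?_
    rw [sum_const, card_range, nsmul_eq_mul]
    have : ((N + 1 : ℕ) : ℝ) * (ε / 2 * (1 / (N + 1 : ℕ))) = ε / 2 := by field_simp
    linarith
  refine ge_of_tendsto' hlim fun N => ?_
  rw [← hsum]
  refine mul_nonneg ?_ (h N)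
  rw [← Complex.ofReal_natCast, ← Complex.ofReal_inv, Complex.zero_le_real]
  positivity

theorem GramPos.sum_rotate_nonneg {d : ℕ} {g : ℂ → ℂ} (hg : GramPos d g) (p : ℤ) (N : ℕ)
    {ι : Type} [Fintype ι] (x : ι → Fin d → ℂ) (v : ι → ℂ) :
    0 ≤ ∑ k : ZMod (N + 1), ∑ r, ∑ s, conj (v r) * v s *
      (fourier (-p) (ZMod.toAddCircle k) *
        g ((∑ i, x r i * conj (x s i)) * fourier 1 (ZMod.toAddCircle k))) := by
  set G := ZMod (N + 1)
  set a : G →+ UnitAddCircle := ZMod.toAddCircle with ha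
  have hcancel : ∀ (n : ℤ) (k l : G), fourier n (a k) * conj (fourier n (a l)) =
      fourier n (a (k - l)) := by
    intro n k l
    rw [← fourier_neg, map_sub, fourier_apply, fourier_apply, fourier_apply, ← Circle.coe_mul,
      ← AddCircle.toCircle_add, smul_sub, neg_smul, sub_eq_add_neg]
  have h := hg (ι × G) (fun q i => x q.1 i * fourier 1 (a q.2)) (fun q => v q.1 * fourier p (a q.2))
  set ψ : G → ℂ := fun k => ∑ r, ∑ s, conj (v r) * v s *
      (fourier (-p) (a k) * g ((∑ i, x r i * conj (x s i)) * fourier 1 (a k))) with hψ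
  have hkl : ∑ q : ι × G, ∑ q' : ι × G,
      conj (v q.1 * fourier p (a q.2)) * (v q'.1 * fourier p (a q'.2)) *
        g (∑ i, x q.1 i * fourier 1 (a q.2) * conj (x q'.1 i * fourier 1 (a q'.2))) =
      ∑ k : G, ∑ l : G, ψ (k - l) := by
    simp only [Fintype.sum_prod_type, hψ]
    rw [sum_comm]
    refine sum_congr rfl fun k _ => ?_
    conv_rhs => rw [sum_comm]
    refine sum_congr rfl fun r _ => ?_
    conv_rhs => rw [sum_comm]
    refine sum_congr rfl fun s _ => sum_congr rfl fun l _ => ?_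
    have h1 : ∑ i, x r i * fourier 1 (a k) * conj (x s i * fourier 1 (a l)) =
        (∑ i, x r i * conj (x s i)) * fourier 1 (a (k - l)) := by
      rw [← hcancel, sum_mul]
      refine sum_congr rfl fun i _ => ?_
      rw [map_mul]
      ring
    have h2 : (fourier (-p) (a (k - l)) : ℂ) = fourier p (a l) * conj (fourier p (a k)) := by
      rw [hcancel, fourier_apply, fourier_apply, ← neg_sub l k, map_neg, smul_neg, neg_smul,
        neg_neg]
    rw [h1, h2, map_mul]
    ring
  rw [hkl, sum_comm] at h
  have hshift : ∀ l : G, ∑ k : G, ψ (k - l) = ∑ k, ψ k := fun l =>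
    Fintype.sum_equiv (Equiv.subRight l) _ _ fun k => rfl
  simp only [hshift, sum_const, nsmul_eq_mul, card_univ] at h
  have hc : (0 : ℝ) < Fintype.card G := by
    exact_mod_cast Fintype.card_pos (α := G)
  rw [Complex.nonneg_iff, ← Complex.ofReal_natCast, Complex.re_ofReal_mul,
    Complex.im_ofReal_mul, zero_eq_mul] at h
  exact Complex.nonneg_iff.2 ⟨nonneg_of_mul_nonneg_right h.1 hc, (h.2.resolve_left hc.ne').symm⟩

/-- The component of `f` of weight `p` under the rotations of the plane. -/
noncomputable def rotComponent (f : ℂ → ℂ) (p : ℤ) (z : ℂ) : ℂ :=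
  fourierCoeff (fun θ : UnitAddCircle => f (z * fourier 1 θ)) p

theorem continuous_mul_fourier {f : ℂ → ℂ} (hf : Continuous f) (z : ℂ) :
    Continuous fun θ : UnitAddCircle => f (z * fourier 1 θ) :=
  hf.comp (continuous_const.mul (fourier 1).continuous)

open AddCircle in
theorem GramPos.rotComponent {d : ℕ} {f : ℂ → ℂ} (hg : GramPos d f) (hf : Continuous f) (p : ℤ) :
    GramPos d (rotComponent f p) := by
  intro ι _ x v
  have hc : ∀ z, Continuous fun θ : UnitAddCircle => fourier (-p) θ * f (z * fourier 1 θ) :=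
    fun z => (fourier (-p)).continuous.mul (continuous_mul_fourier hf z)
  have h := integral_haarAddCircle_nonneg
    (ψ := fun θ => ∑ r, ∑ s, conj (v r) * v s *
      (fourier (-p) θ * f ((∑ i, x r i * conj (x s i)) * fourier 1 θ)))
    (continuous_finsetSum _ fun r _ => continuous_finsetSum _ fun s _ =>
      continuous_const.mul (hc _)) (fun N => hg.sum_rotate_nonneg p N x v)
  have hi : ∀ z, MeasureTheory.Integrable
      (fun θ : UnitAddCircle => fourier (-p) θ * f (z * fourier 1 θ)) haarAddCircle :=
    fun z => (hc z).integrable_of_hasCompactSupport (HasCompactSupport.of_compactSpace _)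
  rw [MeasureTheory.integral_finsetSum _ fun r _ => MeasureTheory.integrable_finsetSum _
    fun s _ => (hi _).const_mul _] at h
  refine h.trans_eq (sum_congr rfl fun r _ => ?_)
  rw [MeasureTheory.integral_finsetSum _ fun s _ => (hi _).const_mul _]
  refine sum_congr rfl fun s _ => ?_
  rw [MeasureTheory.integral_const_mul]
  rfl

open AddCircle in
theorem rotComponent_mul_fourier (f : ℂ → ℂ) (p : ℤ) (z : ℂ) (τ : UnitAddCircle) :
    rotComponent f p (z * fourier 1 τ) = fourier p τ * rotComponent f p z := by
  have h := MeasureTheory.integral_add_right_eq_self (μ := haarAddCircle)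
    (fun θ : UnitAddCircle => fourier (-p) θ • f (z * fourier 1 θ)) τ
  rw [rotComponent, rotComponent, fourierCoeff, fourierCoeff, ← h,
    ← MeasureTheory.integral_const_mul]
  congr 1
  ext θ
  have h1 : (fourier 1 (θ + τ) : ℂ) = fourier 1 τ * fourier 1 θ := by
    simp [fourier_apply, AddCircle.toCircle_add, mul_comm]
  have h2 : (fourier p τ : ℂ) * fourier (-p) (θ + τ) = fourier (-p) θ := by
    simp only [fourier_apply, ← Circle.coe_mul, ← AddCircle.toCircle_add]
    congr 2
    rw [smul_add, add_left_comm, ← add_smul]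
    simp
  rw [smul_eq_mul, smul_eq_mul, h1, ← mul_assoc, h2, mul_assoc]

open AddCircle in
theorem continuous_rotComponent {f : ℂ → ℂ} (hf : Continuous f) (p : ℤ) :
    Continuous (rotComponent f p) := by
  have h : Continuous fun q : ℂ × UnitAddCircle => fourier (-p) q.2 • f (q.1 * fourier 1 q.2) := by
    have h1 := (fourier (T := 1) (-p)).continuous
    have h2 := (fourier (T := 1) 1).continuous
    fun_prop
  have h2 := continuous_parametric_integral_of_continuous (μ := haarAddCircle)
    (f := fun z (θ : UnitAddCircle) => fourier (-p) θ • f (z * fourier 1 θ)) h isCompact_univ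
  simp only [MeasureTheory.Measure.restrict_univ] at h2
  exact h2

theorem norm_fourier_apply (p : ℤ) (θ : UnitAddCircle) : ‖(fourier p θ : ℂ)‖ = 1 := by
  rw [fourier_apply, Circle.norm_coe]

theorem norm_mul_fourier {δ : ℝ} (hδ : 0 ≤ δ) (p : ℤ) (θ : UnitAddCircle) :
    ‖(δ : ℂ) * fourier p θ‖ = δ := by
  rw [norm_mul, norm_fourier_apply, mul_one, Complex.norm_real, Real.norm_of_nonneg hδ]

open AddCircle in
theorem norm_fourierCoeff_le {u : UnitAddCircle → ℂ} {C : ℝ} (h : ∀ θ, ‖u θ‖ ≤ C) (q : ℤ) :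
    ‖fourierCoeff u q‖ ≤ C := by
  have h := MeasureTheory.norm_integral_le_of_norm_le_const (μ := haarAddCircle)
    (f := fun θ : UnitAddCircle => (fourier (-q) θ : ℂ) • u θ) (C := C)
    (Eventually.of_forall fun θ => by
      rw [norm_smul, norm_fourier_apply, one_mul]
      exact h θ)
  rwa [MeasureTheory.probReal_univ, mul_one] at h

theorem FmC.norm_rotComponent_le {m : ℕ} (hm : 3 ≤ m) {f : ℂ → ℂ} (hf : FmC m f) (p : ℤ)
    {r : ℝ} (hr : 0 ≤ r) : ‖rotComponent f p r‖ ≤ (f r).re :=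
  norm_fourierCoeff_le (fun θ => hf.norm_le hm (norm_mul_fourier hr 1 θ).le) p

/-- Positivity of the kernels `(u, v) ↦ F (a + u v)`, `a ≥ 0`, on the half-line. -/
def AffinePos (F : ℝ → ℝ) : Prop :=
  ∀ (n : ℕ) (u v : ℕ → ℝ) (a : ℝ), 0 ≤ a → (∀ i, 0 ≤ u i) →
    0 ≤ ∑ i ∈ range n, ∑ j ∈ range n, v i * v j * F (a + u i * u j)

theorem sum_choose_mul_pow (n k : ℕ) :
    ∑ i ∈ range (n + 1), ((-1 : ℝ) ^ (n - i) * n.choose i) * (i : ℝ) ^ k =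
      (fwdDiff (1 : ℝ))^[n] (fun r : ℝ => r ^ k) 0 := by
  rw [fwdDiff_iter_eq_sum_shift]
  refine sum_congr rfl fun i _ => ?_
  simp [zsmul_eq_mul]

theorem AffinePos.iteratedDeriv_nonneg {G : ℝ → ℝ} (hG : AffinePos G) (n : ℕ)
    (hs : ContDiff ℝ n G) {a : ℝ} (ha : 0 ≤ a) : 0 ≤ iteratedDeriv n G a := by
  set w : ℕ → ℝ := fun i => (-1 : ℝ) ^ (n - i) * n.choose i with hw
  have hw0 : ∀ k < n, ∑ i ∈ range (n + 1), w i * (i : ℝ) ^ k = 0 := fun k hk => by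
    rw [hw, sum_choose_mul_pow, fwdDiff_iter_pow_eq_zero_of_lt hk]
    rfl
  have hwn : ∑ i ∈ range (n + 1), w i * (i : ℝ) ^ n = (n.factorial : ℝ) := by
    rw [hw, sum_choose_mul_pow, fwdDiff_iter_eq_factorial]
    simp
  set R : ℝ → ℝ := fun x => G x - taylorWithinEval G n Set.univ a x with hR
  have hRo : R =o[𝓝 a] fun x => (x - a) ^ n := taylor_isLittleO_univ hs
  have hGx : ∀ x, G x = ∑ k ∈ range (n + 1),
      ((k.factorial : ℝ)⁻¹ * (x - a) ^ k) * iteratedDeriv k G a + R x := fun x => by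
    rw [hR]
    simp [taylor_within_apply, iteratedDerivWithin_univ]
  have hmoment : ∀ s : ℝ, ∑ i ∈ range (n + 1), ∑ j ∈ range (n + 1), w i * w j *
      (∑ k ∈ range (n + 1), ((k.factorial : ℝ)⁻¹ * (s * (i * j)) ^ k) * iteratedDeriv k G a) =
      n.factorial * s ^ n * iteratedDeriv n G a := fun s => by
    have h1 : ∑ i ∈ range (n + 1), ∑ j ∈ range (n + 1), w i * w j *
      (∑ k ∈ range (n + 1), ((k.factorial : ℝ)⁻¹ * (s * (i * j)) ^ k) * iteratedDeriv k G a) =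
      ∑ k ∈ range (n + 1), ((k.factorial : ℝ)⁻¹ * s ^ k * iteratedDeriv k G a) *
        ((∑ i ∈ range (n + 1), w i * (i : ℝ) ^ k) * ∑ j ∈ range (n + 1), w j * (j : ℝ) ^ k) := by
      simp only [mul_sum, sum_mul]
      rw [sum_comm_cycle]
      refine sum_congr rfl fun k _ => ?_
      rw [sum_comm]
      refine sum_congr rfl fun i _ => sum_congr rfl fun j _ => ?_
      rw [mul_pow, mul_pow]
      ring
    rw [h1, sum_range_succ, sum_eq_zero fun k hk => by rw [hw0 k (mem_range.1 hk)]; ring, hwn]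
    have := Nat.cast_ne_zero (R := ℝ).2 n.factorial_ne_zero
    field_simp
    ring
  have hpos : ∀ s : ℝ, 0 ≤ s → 0 ≤ n.factorial * s ^ n * iteratedDeriv n G a +
      ∑ i ∈ range (n + 1), ∑ j ∈ range (n + 1), w i * w j * R (a + s * (i * j)) := fun s hs0 => by
    have h := hG (n + 1) (fun i => √s * i) w a ha fun i => by positivity
    rw [← hmoment, ← sum_add_distrib]
    refine h.trans_eq (sum_congr rfl fun i _ => ?_)
    rw [← sum_add_distrib]
    refine sum_congr rfl fun j _ => ?_
    have : √s * i * (√s * j) = s * (i * j) := by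
      rw [mul_mul_mul_comm, Real.mul_self_sqrt hs0]
    rw [this, hGx, add_sub_cancel_left]
    ring
  have hrem : (fun s : ℝ => ∑ i ∈ range (n + 1), ∑ j ∈ range (n + 1),
      w i * w j * R (a + s * (i * j))) =o[𝓝 0] fun s : ℝ => s ^ n := by
    refine Asymptotics.IsLittleO.fun_sum fun i _ => ?_
    refine Asymptotics.IsLittleO.fun_sum fun j _ => ?_
    refine Asymptotics.IsLittleO.const_mul_left ?_ _
    have ht : Tendsto (fun s : ℝ => a + s * ((i : ℝ) * j)) (𝓝 0) (𝓝 a) := by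
      have : Continuous fun s : ℝ => a + s * ((i : ℝ) * j) := by fun_prop
      simpa using this.tendsto 0
    refine (hRo.comp_tendsto ht).trans_isBigO ?_
    refine ((Asymptotics.isBigO_refl (fun s : ℝ => s ^ n) _).const_mul_left
      (((i : ℝ) * j) ^ n)).congr_left fun s => ?_
    simp [mul_pow, mul_comm]
  have hlim : Tendsto (fun s : ℝ => n.factorial * iteratedDeriv n G a +
      (∑ i ∈ range (n + 1), ∑ j ∈ range (n + 1), w i * w j * R (a + s * (i * j))) / s ^ n)
      (𝓝[>] 0) (𝓝 (n.factorial * iteratedDeriv n G a + 0)) :=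
    tendsto_const_nhds.add (hrem.tendsto_div_nhds_zero.mono_left nhdsWithin_le_nhds)
  have h0 := ge_of_tendsto hlim (b := 0) (by
    filter_upwards [self_mem_nhdsWithin] with s hs0
    have hs0 : 0 < s := hs0
    have h := div_nonneg (hpos s hs0.le) (pow_nonneg hs0.le n)
    rw [add_div] at h
    refine h.trans_eq ?_
    field_simp)
  rw [add_zero] at h0
  exact nonneg_of_mul_nonneg_right h0 (by positivity)

theorem exists_taylor_remainder {G : ℝ → ℝ} (hs : ContDiff ℝ (⊤ : ℕ∞) G) (n : ℕ) {y x : ℝ}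
    (hyx : y < x) : ∃ ξ ∈ Set.Ioo y x,
      G x = ∑ k ∈ range (n + 1), iteratedDeriv k G y / k.factorial * (x - y) ^ k +
        iteratedDeriv (n + 1) G ξ / (n + 1).factorial * (x - y) ^ (n + 1) := by
  have hs' : ∀ k : ℕ, ContDiff ℝ k G := fun k => hs.of_le (by exact_mod_cast le_top)
  obtain ⟨ξ, hξ, h⟩ := taylor_mean_remainder_lagrange_iteratedDeriv (n := n) hyx.ne
    (by exact_mod_cast (hs' (n + 1)).contDiffOn)
  rw [Set.uIoo_of_lt hyx] at hξ
  refine ⟨ξ, hξ, ?_⟩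
  rw [taylor_within_apply, sub_eq_iff_eq_add'] at h
  rw [h]
  congr 1
  · refine sum_congr rfl fun k _ => ?_
    rw [iteratedDerivWithin_eq_iteratedDeriv (uniqueDiffOn_uIcc hyx.ne) (hs' k).contDiffAt
      Set.left_mem_uIcc, smul_eq_mul]
    ring
  · ring

/-- Bernstein's theorem for smooth functions on the half-line. -/
theorem hasSum_of_iteratedDeriv_nonneg {G : ℝ → ℝ} (hs : ContDiff ℝ (⊤ : ℕ∞) G)
    (hG : ∀ (n : ℕ) (a : ℝ), 0 ≤ a → 0 ≤ iteratedDeriv n G a) {x : ℝ} (hx : 0 ≤ x) :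
    HasSum (fun n : ℕ => iteratedDeriv n G 0 / n.factorial * x ^ n) (G x) := by
  rcases hx.eq_or_lt with rfl | hx0
  · convert hasSum_ite_eq (0 : ℕ) (G 0) using 2 with n
    rcases n with _ | n <;> simp
  have hterm : ∀ (n : ℕ) (y h : ℝ), 0 ≤ y → 0 < h →
      iteratedDeriv n G y / n.factorial * h ^ n ≤ G (y + h) := fun n y h hy hh => by
    obtain ⟨ξ, hξ, e⟩ := exists_taylor_remainder hs n (show y < y + h by linarith)
    rw [e, sum_range_succ, add_sub_cancel_left]
    have h1 : 0 ≤ ∑ k ∈ range n, iteratedDeriv k G y / k.factorial * h ^ k :=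
      sum_nonneg fun k _ => mul_nonneg (div_nonneg (hG k y hy) (by positivity)) (by positivity)
    have h2 : 0 ≤ iteratedDeriv (n + 1) G ξ / (n + 1).factorial * h ^ (n + 1) :=
      mul_nonneg (div_nonneg (hG _ ξ (hy.trans hξ.1.le)) (by positivity)) (by positivity)
    linarith
  have hmono : ∀ y z : ℝ, 0 ≤ y → y < z → G y ≤ G z := fun y z hy hyz => by
    have := hterm 0 y (z - y) hy (sub_pos.2 hyz)
    simpa using this
  refine (hasSum_iff_tendsto_nat_of_nonneg (fun n => mul_nonneg
    (div_nonneg (hG n 0 le_rfl) (by positivity)) (by positivity)) _).2 ?_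
  rw [← tendsto_add_atTop_iff_nat 1]
  have hb : Tendsto (fun n : ℕ => G x - G (3 * x) * (1 / 2 : ℝ) ^ (n + 1)) atTop (𝓝 (G x)) := by
    have := ((tendsto_pow_atTop_nhds_zero_of_lt_one (r := (1 / 2 : ℝ)) (by norm_num)
      (by norm_num)).comp (tendsto_add_atTop_nat 1)).const_mul (G (3 * x))
    simpa using tendsto_const_nhds.sub this
  refine tendsto_of_tendsto_of_tendsto_of_le_of_le hb tendsto_const_nhds (fun n => ?_) fun n => ?_
  · obtain ⟨ξ, hξ, e⟩ := exists_taylor_remainder hs n hx0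
    simp only [sub_zero] at e
    have h1 := hterm (n + 1) ξ (2 * x) hξ.1.le (by linarith)
    have h2 := hmono (ξ + 2 * x) (3 * x) (by linarith [hξ.1]) (by linarith [hξ.2])
    have h3 : iteratedDeriv (n + 1) G ξ / (n + 1).factorial * x ^ (n + 1) =
        iteratedDeriv (n + 1) G ξ / (n + 1).factorial * (2 * x) ^ (n + 1) *
          (1 / 2 : ℝ) ^ (n + 1) := by
      rw [mul_assoc, ← mul_pow]
      congr 2
      ring
    have h4 : iteratedDeriv (n + 1) G ξ / (n + 1).factorial * x ^ (n + 1) ≤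
        G (3 * x) * (1 / 2 : ℝ) ^ (n + 1) := by
      rw [h3]
      exact mul_le_mul_of_nonneg_right (h1.trans h2) (by positivity)
    linarith
  · obtain ⟨ξ, hξ, e⟩ := exists_taylor_remainder hs n hx0
    simp only [sub_zero] at e
    have h2 : 0 ≤ iteratedDeriv (n + 1) G ξ / (n + 1).factorial * x ^ (n + 1) :=
      mul_nonneg (div_nonneg (hG _ ξ hξ.1.le) (by positivity)) (by positivity)
    linarith

open MeasureTheory ContDiffBump Convolution in
theorem AffinePos.exists_smooth_approx {F : ℝ → ℝ} (hF : AffinePos F) (hc : Continuous F) :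
    ∃ G : ℕ → ℝ → ℝ, (∀ k, ContDiff ℝ (⊤ : ℕ∞) (G k)) ∧ (∀ k, AffinePos (G k)) ∧
      (∀ x, Tendsto (fun k => G k x) atTop (𝓝 (F x))) ∧
      ∀ k x M, (∀ y ∈ Set.Icc x (x + 2), F y ≤ M) → G k x ≤ M := by
  let φ : ℕ → ContDiffBump (0 : ℝ) := fun k =>
    ⟨1 / (2 * (k + 1)), 1 / (k + 1), by positivity, by
      apply one_div_lt_one_div_of_lt <;> linarith [(Nat.cast_nonneg k : (0 : ℝ) ≤ k)]⟩
  have hro : ∀ k, (φ k).rOut = 1 / ((k : ℝ) + 1) := fun k => rfl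
  have hro1 : ∀ k, (φ k).rOut ≤ 1 := fun k => by
    rw [hro, div_le_one (by positivity)]
    linarith [(Nat.cast_nonneg k : (0 : ℝ) ≤ k)]
  have hr0 : ∀ k, 0 < (φ k).rOut := fun k => (φ k).rOut_pos
  have hφ : Tendsto (fun k => (φ k).rOut) atTop (𝓝 0) := tendsto_one_div_add_atTop_nhds_zero_nat
  have hsupp : ∀ k t, (φ k).normed volume t ≠ 0 → |t| < (φ k).rOut := fun k t ht => by
    have : t ∈ Function.support ((φ k).normed volume) := ht
    rw [(φ k).support_normed_eq] at this
    simpa using this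
  have hint : ∀ k x, Integrable (fun t => (φ k).normed volume t * F (x - t)) := fun k x =>
    Continuous.integrable_of_hasCompactSupport
      ((φ k).continuous_normed.mul (hc.comp (by fun_prop)))
      ((φ k).hasCompactSupport_normed.mul_right)
  have hGx : ∀ k x, (((φ k).normed volume) ⋆[ContinuousLinearMap.lsmul ℝ ℝ, volume] F) x =
      ∫ t, (φ k).normed volume t * F (x - t) := fun k x => rfl
  refine ⟨fun k x => (((φ k).normed volume) ⋆[ContinuousLinearMap.lsmul ℝ ℝ, volume] F)
    (x + (φ k).rOut), fun k => ?_, fun k => ?_, fun x => ?_, fun k x M hM => ?_⟩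
  · have := (φ k).hasCompactSupport_normed (μ := volume)|>.contDiff_convolution_left
      (ContinuousLinearMap.lsmul ℝ ℝ) (φ k).contDiff_normed (n := ⊤) hc.locallyIntegrable
      (μ := volume)
    exact this.comp (by fun_prop)
  · intro n u v a ha hu
    have h : 0 ≤ ∫ t, (φ k).normed volume t * ∑ i ∈ range n, ∑ j ∈ range n,
        v i * v j * F (a + u i * u j + (φ k).rOut - t) := by
      refine integral_nonneg fun t => ?_
      by_cases ht : (φ k).normed volume t = 0
      · simp [ht]
      · have h2 := (abs_lt.1 (hsupp k t ht)).2
        have h1 := hF n u v (a + (φ k).rOut - t) (by linarith) hu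
        refine mul_nonneg ((φ k).nonneg_normed t) (h1.trans_eq ?_)
        refine sum_congr rfl fun i _ => sum_congr rfl fun j _ => ?_
        congr 2
        ring
    refine h.trans_eq ?_
    simp only [mul_sum, hGx]
    have hi : ∀ i j, Integrable fun t => (φ k).normed volume t *
        (v i * v j * F (a + u i * u j + (φ k).rOut - t)) := fun i j =>
      ((hint k (a + u i * u j + (φ k).rOut)).const_mul (v i * v j)).congr
        (Eventually.of_forall fun t => by ring)
    rw [integral_finsetSum _ fun i _ => integrable_finsetSum _ fun j _ => hi i j]
    refine sum_congr rfl fun i _ => ?_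
    rw [integral_finsetSum _ fun j _ => hi i j]
    refine sum_congr rfl fun j _ => ?_
    rw [← integral_const_mul]
    congr 1
    ext t
    ring
  · refine ContDiffBump.convolution_tendsto_right hφ
      (Eventually.of_forall fun _ => hc.aestronglyMeasurable) ((hc.tendsto x).comp tendsto_snd) ?_
    simpa using hφ.const_add x
  · have h1 : ∫ t, (φ k).normed volume t * F (x + (φ k).rOut - t) ≤
        ∫ t, (φ k).normed volume t * M := by
      refine integral_mono (hint k _) ((φ k).integrable_normed.mul_const M) fun t => ?_
      by_cases ht : (φ k).normed volume t = 0
      · simp [ht]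
      · have h2 := abs_lt.1 (hsupp k t ht)
        exact mul_le_mul_of_nonneg_left (hM _ ⟨by linarith, by linarith [hro1 k]⟩)
          ((φ k).nonneg_normed t)
    rwa [integral_mul_const, (φ k).integral_normed, one_mul] at h1

/-- A continuous function on the half-line whose kernels are positive is the sum of a power series
with nonnegative coefficients. -/
theorem AffinePos.exists_hasSum {F : ℝ → ℝ} (hF : AffinePos F) (hc : Continuous F) :
    ∃ c : ℕ → ℝ, (∀ n, 0 ≤ c n) ∧ ∀ x, 0 ≤ x → HasSum (fun n => c n * x ^ n) (F x) := by
  obtain ⟨G, hs, hG, hlim, hbd⟩ := hF.exists_smooth_approx hc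
  set d : ℕ → ℕ → ℝ := fun k n => iteratedDeriv n (G k) 0 / n.factorial with hd
  have hder : ∀ k n a, 0 ≤ a → 0 ≤ iteratedDeriv n (G k) a := fun k n a ha =>
    (hG k).iteratedDeriv_nonneg n ((hs k).of_le (by exact_mod_cast le_top)) ha
  have hd0 : ∀ k n, 0 ≤ d k n := fun k n => div_nonneg (hder k n 0 le_rfl) (by positivity)
  have hsum : ∀ k x, 0 ≤ x → HasSum (fun n => d k n * x ^ n) (G k x) := fun k x hx =>
    hasSum_of_iteratedDeriv_nonneg (hs k) (hder k) hx
  have hM : ∀ x, ∃ M, ∀ k, G k x ≤ M := fun x => by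
    obtain ⟨M, hM⟩ := (isCompact_Icc (a := x) (b := x + 2)).bddAbove_image hc.continuousOn
    exact ⟨M, fun k => hbd k x M fun y hy => hM (Set.mem_image_of_mem F hy)⟩
  choose M hM using hM
  have hdM : ∀ x, 0 ≤ x → ∀ k n, d k n * x ^ n ≤ M x := fun x hx k n =>
    (le_hasSum (hsum k x hx) n fun j _ => mul_nonneg (hd0 k j) (pow_nonneg hx j)).trans (hM x k)
  obtain ⟨c, hc', ψ, hψ, hψc⟩ := (isCompact_univ_pi fun _ : ℕ => isCompact_Icc (a := (0 : ℝ))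
    (b := M 1)).tendsto_subseq (x := d) fun k n _ => ⟨hd0 k n, by simpa using hdM 1 zero_le_one k n⟩
  have hcn : ∀ n, Tendsto (fun j => d (ψ j) n) atTop (𝓝 (c n)) := fun n =>
    (tendsto_pi_nhds.1 hψc) n
  refine ⟨c, fun n => (hc' n trivial).1, fun x hx => ?_⟩
  have hbound : ∀ k n, d k n * x ^ n ≤ M (2 * x) * (1 / 2 : ℝ) ^ n := fun k n => by
    have h := hdM (2 * x) (by positivity) k n
    have : d k n * x ^ n = d k n * (2 * x) ^ n * (1 / 2 : ℝ) ^ n := by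
      rw [mul_assoc, ← mul_pow]
      congr 2
      ring
    rw [this]
    exact mul_le_mul_of_nonneg_right h (by positivity)
  have hgeo : Summable fun n : ℕ => M (2 * x) * (1 / 2 : ℝ) ^ n :=
    (summable_geometric_of_lt_one (by norm_num) (by norm_num)).mul_left _
  have hterm : ∀ n, Tendsto (fun j => d (ψ j) n * x ^ n) atTop (𝓝 (c n * x ^ n)) := fun n =>
    (hcn n).mul_const _
  have ht := tendsto_tsum_of_dominated_convergence (bound := fun n => M (2 * x) * (1 / 2 : ℝ) ^ n)
    hgeo hterm (Eventually.of_forall fun j n => by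
      rw [Real.norm_of_nonneg (mul_nonneg (hd0 _ n) (pow_nonneg hx n))]
      exact hbound _ n)
  have hS : Summable fun n => c n * x ^ n :=
    Summable.of_nonneg_of_le (fun n => mul_nonneg (hc' n trivial).1 (pow_nonneg hx n))
      (fun n => le_of_tendsto (hterm n) (Eventually.of_forall fun j => hbound _ n)) hgeo
  have heq : ∑' n, c n * x ^ n = F x := by
    refine tendsto_nhds_unique ht ?_
    simp only [(hsum _ x hx).tsum_eq]
    exact (hlim x).comp hψ.tendsto_atTop
  exact heq ▸ hS.hasSum

theorem GramPos.exists_hasSum {g : ℂ → ℂ} (hg : GramPos 3 g) (hc : Continuous g) :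
    ∃ c : ℕ → ℝ, (∀ n, 0 ≤ c n) ∧
      ∀ r : ℝ, 0 ≤ r → HasSum (fun n => (c n : ℂ) * (r : ℂ) ^ n) (g r) := by
  set F : ℝ → ℝ := fun x => (g ((max x 0 : ℝ) : ℂ)).re with hF
  have hgF : ∀ r : ℝ, 0 ≤ r → g r = F r := fun r hr => by
    rw [hF]
    simp only [max_eq_left hr]
    exact Complex.eq_re_of_ofReal_le (r := 0) (by simpa using hg.nonneg hr)
  have hFp : AffinePos F := fun n u v a ha hu => by
    have h := hg (Fin n) (fun i => ![(√a : ℂ), (u i : ℂ), 0]) (fun i => (v i : ℂ))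
    have h2 : ∀ i j : Fin n, g (∑ k, ![(√a : ℂ), (u i : ℂ), 0] k *
        conj (![(√a : ℂ), (u j : ℂ), 0] k)) = F (a + u i * u j) := fun i j => by
      rw [← hgF _ (add_nonneg ha (mul_nonneg (hu i) (hu j)))]
      simp [Fin.sum_univ_three, ← Complex.ofReal_mul, Real.mul_self_sqrt ha]
    simp only [h2, Complex.conj_ofReal] at h
    rw [sum_range]
    simp only [sum_range]
    exact_mod_cast h
  obtain ⟨c, hc0, hc1⟩ := hFp.exists_hasSum
    (Complex.continuous_re.comp (hc.comp (Complex.continuous_ofReal.comp (by fun_prop))))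
  refine ⟨c, hc0, fun r hr => ?_⟩
  rw [hgF r hr]
  have h := (hc1 r hr).mapL Complex.ofRealCLM
  simpa using h

/-- The function `r e^{iτ} ↦ r ^ n e^{ipτ}`. -/
noncomputable def weightedPow (p : ℤ) (n : ℕ) (z : ℂ) : ℂ :=
  Complex.exp (p * z.arg * Complex.I) * (‖z‖ : ℂ) ^ n

theorem norm_weightedPow (p : ℤ) (n : ℕ) (z : ℂ) : ‖weightedPow p n z‖ = ‖z‖ ^ n := by
  rw [weightedPow, norm_mul, norm_pow, Complex.norm_real, norm_norm]
  have : (p * z.arg * Complex.I : ℂ) = ((p * z.arg : ℝ) : ℂ) * Complex.I := by push_cast; ring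
  rw [this, Complex.norm_exp_ofReal_mul_I, one_mul]

theorem weightedPow_real_mul (p : ℤ) (n : ℕ) {r : ℝ} (hr : 0 < r) (z : ℂ) :
    weightedPow p n (r * z) = (r : ℂ) ^ n * weightedPow p n z := by
  rw [weightedPow, weightedPow, Complex.arg_real_mul _ hr, norm_mul, Complex.norm_real,
    Real.norm_of_nonneg hr.le, Complex.ofReal_mul, mul_pow]
  ring

theorem weightedPow_eq_mul_conj (j k : ℕ) (z : ℂ) :
    weightedPow (j - k) (j + k) z = z ^ j * conj z ^ k := by
  have h := Complex.norm_mul_exp_arg_mul_I z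
  have h2 : conj z = ‖z‖ * Complex.exp (-(z.arg * Complex.I)) := by
    conv_lhs => rw [← h]
    rw [map_mul, Complex.conj_ofReal, ← Complex.exp_conj, map_mul, Complex.conj_ofReal,
      Complex.conj_I, mul_neg]
  rw [h2]
  conv_rhs => enter [1]; rw [← h]
  rw [mul_pow, mul_pow, ← Complex.exp_nat_mul, ← Complex.exp_nat_mul, weightedPow, pow_add]
  have : Complex.exp (((j - k : ℤ) : ℂ) * z.arg * Complex.I) =
      Complex.exp (j * (z.arg * Complex.I)) * Complex.exp (k * -(z.arg * Complex.I)) := by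
    rw [← Complex.exp_add]
    congr 1
    push_cast
    ring
  rw [this]
  ring

theorem norm_mul_fourier_arg (z : ℂ) :
    z = ‖z‖ * fourier (T := 1) 1 ((z.arg / (2 * Real.pi) : ℝ) : UnitAddCircle) := by
  conv_lhs => rw [← Complex.norm_mul_exp_arg_mul_I z]
  rw [fourier_coe_apply]
  congr 2
  have := Complex.ofReal_ne_zero.2 Real.pi_ne_zero
  push_cast
  field_simp

theorem fourier_arg (p : ℤ) (z : ℂ) :
    fourier (T := 1) p ((z.arg / (2 * Real.pi) : ℝ) : UnitAddCircle) =
      Complex.exp (p * z.arg * Complex.I) := by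
  rw [fourier_coe_apply]
  congr 1
  have := Complex.ofReal_ne_zero.2 Real.pi_ne_zero
  push_cast
  field_simp

theorem hasSum_weightedPow {g : ℂ → ℂ} {p : ℤ} {c : ℕ → ℝ}
    (hw : ∀ (z : ℂ) (τ : UnitAddCircle), g (z * fourier 1 τ) = fourier p τ * g z)
    (hs : ∀ r : ℝ, 0 ≤ r → HasSum (fun n => (c n : ℂ) * (r : ℂ) ^ n) (g r)) (z : ℂ) :
    HasSum (fun n => (c n : ℂ) * weightedPow p n z) (g z) := by
  have hz : g z = Complex.exp (p * z.arg * Complex.I) * g ‖z‖ := by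
    rw [← fourier_arg, ← hw, ← norm_mul_fourier_arg]
  rw [hz]
  have h : ∀ n, (c n : ℂ) * weightedPow p n z =
      Complex.exp (p * z.arg * Complex.I) * (c n * (‖z‖ : ℂ) ^ n) := fun n => by
    rw [weightedPow]
    ring
  simp only [h]
  exact (hs ‖z‖ (norm_nonneg z)).mul_left _

theorem continuous_weightedPow {X : Type*} [TopologicalSpace X] (p : ℤ) (n : ℕ) {w : X → ℂ}
    (hw : Continuous w) (h : ∀ x, w x ∈ Complex.slitPlane) :
    Continuous fun x => weightedPow p n (w x) := by
  have h1 : Continuous fun x => (w x).arg :=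
    continuous_iff_continuousAt.2 fun x =>
      (Complex.continuousAt_arg (h x)).comp hw.continuousAt
  unfold weightedPow
  fun_prop

theorem one_add_mem_slitPlane {w : ℂ} (hw : ‖w‖ < 1) : 1 + w ∈ Complex.slitPlane := by
  refine Or.inl ?_
  have := (abs_le.1 (Complex.abs_re_le_norm w)).1
  simp only [Complex.add_re, Complex.one_re]
  linarith

theorem weightedPow_one_add {p : ℤ} {n : ℕ} {w : ℂ} (hw : ‖w‖ < 1) :
    weightedPow p n (1 + w) =
      (1 + w) ^ (((n + p) / 2 : ℝ) : ℂ) * (1 + conj w) ^ (((n - p) / 2 : ℝ) : ℂ) := by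
  have hs := one_add_mem_slitPlane hw
  have h0 := Complex.slitPlane_ne_zero hs
  have h0' : 1 + conj w ≠ 0 := by simpa using (map_ne_zero conj).2 h0
  have hl : Complex.log (1 + conj w) = conj (Complex.log (1 + w)) := by
    rw [← Complex.log_conj _ (Complex.mem_slitPlane_iff_arg.1 hs).1]
    simp
  rw [Complex.cpow_def_of_ne_zero h0, Complex.cpow_def_of_ne_zero h0', hl, ← Complex.exp_add,
    weightedPow]
  have h1 : (‖1 + w‖ : ℂ) = Complex.exp (Complex.log (1 + w)).re := by
    rw [Complex.log_re, ← Complex.ofReal_exp, Real.exp_log (norm_pos_iff.2 h0)]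
  rw [h1, ← Complex.exp_nat_mul, ← Complex.exp_add, ← Complex.log_im]
  congr 1
  conv_rhs => rw [← Complex.re_add_im (Complex.log (1 + w))]
  simp only [map_add, map_mul, Complex.conj_ofReal, Complex.conj_I]
  push_cast
  ring

theorem fourier_pow_mul_conj_pow (a b : ℕ) (θ : UnitAddCircle) :
    (fourier 1 θ : ℂ) ^ a * conj (fourier 1 θ : ℂ) ^ b = fourier (a - b : ℤ) θ := by
  have h : ∀ k : ℕ, (fourier 1 θ : ℂ) ^ k = fourier (k : ℤ) θ := fun k => by
    rw [fourier_apply, fourier_apply, one_smul, natCast_zsmul, AddCircle.toCircle_nsmul,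
      Circle.coe_pow]
  rw [← map_pow conj, h, h, ← fourier_neg, ← fourier_add, sub_eq_add_neg]

open AddCircle in
theorem fourierCoeff_sum_mul_sum (A B : ℕ → ℂ) (M N : ℕ) (δ : ℂ) (q : ℤ) :
    fourierCoeff (fun θ : UnitAddCircle => (∑ a ∈ range M, A a * (δ * fourier 1 θ) ^ a) *
      ∑ b ∈ range N, B b * (δ * conj (fourier 1 θ : ℂ)) ^ b) q =
      ∑ a ∈ range M, ∑ b ∈ range N,
        A a * B b * δ ^ (a + b) * (Pi.single (a - b : ℤ) 1 : ℤ → ℂ) q := by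
  have h : (fun θ : UnitAddCircle => (∑ a ∈ range M, A a * (δ * fourier 1 θ) ^ a) *
      ∑ b ∈ range N, B b * (δ * conj (fourier 1 θ : ℂ)) ^ b) =
      ∑ a ∈ range M, ∑ b ∈ range N, fun θ : UnitAddCircle =>
        A a * B b * δ ^ (a + b) * fourier (a - b : ℤ) θ := by
    ext θ
    rw [sum_mul_sum]
    simp only [Finset.sum_apply]
    refine sum_congr rfl fun a _ => sum_congr rfl fun b _ => ?_
    rw [← fourier_pow_mul_conj_pow]
    ring
  have hi : ∀ a b : ℕ, MeasureTheory.Integrable (fun θ : UnitAddCircle =>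
      A a * B b * δ ^ (a + b) * fourier (a - b : ℤ) θ) haarAddCircle := fun a b =>
    (continuous_const.mul (fourier _).continuous).integrable_of_hasCompactSupport
      (HasCompactSupport.of_compactSpace _)
  rw [h, fourierCoeff.sum _ _ fun a _ => MeasureTheory.integrable_finsetSum' _ fun b _ => hi a b,
    Finset.sum_apply]
  refine sum_congr rfl fun a _ => ?_
  rw [fourierCoeff.sum _ _ fun b _ => hi a b, Finset.sum_apply]
  refine sum_congr rfl fun b _ => ?_
  rw [fourierCoeff.const_mul, fourierCoeff_fourier]

/-- The Fourier coefficients of `weightedPow p n` on the circle of radius `δ` around `1`. -/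
noncomputable def weightedCoeff (p : ℤ) (n : ℕ) (δ : ℝ) (q : ℤ) : ℂ :=
  fourierCoeff (fun θ : UnitAddCircle => weightedPow p n (1 + δ * fourier 1 θ)) q

theorem norm_weightedCoeff_le (p : ℤ) (n : ℕ) {δ : ℝ} (hδ : 0 ≤ δ) (hδ1 : δ < 1) (q : ℤ) :
    ‖weightedCoeff p n δ q‖ ≤ 2 ^ n := by
  refine norm_fourierCoeff_le (fun θ => ?_) q
  rw [norm_weightedPow]
  refine pow_le_pow_left₀ (norm_nonneg _) ((norm_add_le _ _).trans ?_) n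
  rw [norm_mul_fourier hδ, norm_one]
  linarith

theorem weightedCoeff_eq_zero (j k : ℕ) (δ : ℝ) {q : ℤ} (hq : j + k < |q|) :
    weightedCoeff (j - k) (j + k) δ q = 0 := by
  have h : (fun θ : UnitAddCircle => weightedPow (j - k) (j + k) (1 + δ * fourier 1 θ)) =
      fun θ => (∑ a ∈ range (j + 1), (j.choose a : ℂ) * (δ * fourier 1 θ) ^ a) *
        ∑ b ∈ range (k + 1), (k.choose b : ℂ) * (δ * conj (fourier 1 θ : ℂ)) ^ b := by
    ext θ
    rw [weightedPow_eq_mul_conj, map_add, map_one, map_mul, Complex.conj_ofReal, add_comm, add_pow,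
      add_comm 1, add_pow]
    simp only [one_pow, one_mul, mul_comm]
  rw [weightedCoeff, h, fourierCoeff_sum_mul_sum]
  refine sum_eq_zero fun a ha => sum_eq_zero fun b hb => ?_
  rw [Pi.single_eq_of_ne, mul_zero]
  rintro rfl
  rw [mem_range] at ha hb
  rw [lt_abs] at hq
  omega

open AddCircle in
theorem GramPos.weighted_tsum_nonneg {g : ℂ → ℂ} (hg : GramPos 3 g) (hc : Continuous g) {p : ℤ}
    {c : ℕ → ℝ} (hc0 : ∀ n, 0 ≤ c n)
    (hw : ∀ (z : ℂ) (τ : UnitAddCircle), g (z * fourier 1 τ) = fourier p τ * g z)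
    (hs : ∀ r : ℝ, 0 ≤ r → HasSum (fun n => (c n : ℂ) * (r : ℂ) ^ n) (g r)) {r δ : ℝ} (hr : 0 < r)
    (hδ : 0 ≤ δ) (hδ1 : δ < 1) (q : ℤ) :
    0 ≤ ∑' n, (c n : ℂ) * (r : ℂ) ^ n * weightedCoeff p n δ q := by
  have h := ((hg.comp_const_add hr.le).rotComponent (f := fun z => g (r + z))
    (hc.comp (by fun_prop)) q).nonneg (mul_nonneg hr.le hδ)
  refine h.trans_eq ?_
  have hexp : ∀ θ : UnitAddCircle, HasSum (fun n => (c n : ℂ) * (r : ℂ) ^ n *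
      (fourier (-q) θ * weightedPow p n (1 + δ * fourier 1 θ)))
      (fourier (-q) θ * g (r + ((r * δ : ℝ) : ℂ) * fourier 1 θ)) := fun θ => by
    have h1 := (hasSum_weightedPow hw hs (r + ((r * δ : ℝ) : ℂ) * fourier 1 θ)).mul_left
      (fourier (-q) θ)
    have h2 : (r : ℂ) + ((r * δ : ℝ) : ℂ) * fourier 1 θ = r * (1 + δ * fourier 1 θ) := by
      push_cast
      ring
    have h3 : ∀ n, (c n : ℂ) * (r : ℂ) ^ n *
        (fourier (-q) θ * weightedPow p n (1 + δ * fourier 1 θ)) =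
        fourier (-q) θ * (c n * weightedPow p n (r + ((r * δ : ℝ) : ℂ) * fourier 1 θ)) :=
      fun n => by
        rw [h2, weightedPow_real_mul p n hr]
        ring
    simp only [h3]
    exact h1
  have hcont : ∀ n, Continuous fun θ : UnitAddCircle =>
      (c n : ℂ) * (r : ℂ) ^ n * (fourier (-q) θ * weightedPow p n (1 + δ * fourier 1 θ)) :=
    fun n => continuous_const.mul ((fourier (-q)).continuous.mul (continuous_weightedPow p n
      (continuous_const.add (continuous_const.mul (fourier 1).continuous)) fun θ =>
        one_add_mem_slitPlane (by rwa [norm_mul_fourier hδ])))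
  have hnorm : ∀ n (θ : UnitAddCircle), ‖(c n : ℂ) * (r : ℂ) ^ n *
      (fourier (-q) θ * weightedPow p n (1 + δ * fourier 1 θ))‖ ≤ c n * (2 * r) ^ n := fun n θ => by
    rw [norm_mul, norm_mul, norm_mul, norm_fourier_apply, norm_weightedPow, norm_pow,
      Complex.norm_real, Complex.norm_real, Real.norm_of_nonneg hr.le, Real.norm_of_nonneg (hc0 n),
      one_mul, mul_pow, mul_comm (2 ^ n), ← mul_assoc]
    refine mul_le_mul_of_nonneg_left (pow_le_pow_left₀ (norm_nonneg _)
      ((norm_add_le _ _).trans ?_) n) (mul_nonneg (hc0 n) (by positivity))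
    rw [norm_mul_fourier hδ, norm_one]
    linarith
  have hsum : Summable fun n => c n * (2 * r) ^ n := by
    have := (hs (2 * r) (by positivity)).summable
    exact_mod_cast this
  have hint := MeasureTheory.hasSum_integral_of_summable_integral_norm (μ := haarAddCircle)
    (F := fun n (θ : UnitAddCircle) => (c n : ℂ) * (r : ℂ) ^ n *
      (fourier (-q) θ * weightedPow p n (1 + δ * fourier 1 θ)))
    (fun n => (hcont n).integrable_of_hasCompactSupport (HasCompactSupport.of_compactSpace _))
    (Summable.of_nonneg_of_le (fun n => MeasureTheory.integral_nonneg fun _ => norm_nonneg _)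
      (fun n => by
        have := MeasureTheory.norm_integral_le_of_norm_le_const (μ := haarAddCircle)
          (f := fun θ : UnitAddCircle => ‖(c n : ℂ) * (r : ℂ) ^ n *
            (fourier (-q) θ * weightedPow p n (1 + δ * fourier 1 θ))‖) (C := c n * (2 * r) ^ n)
          (Eventually.of_forall fun θ => by rw [norm_norm]; exact hnorm n θ)
        rw [MeasureTheory.probReal_univ, mul_one] at this
        exact (Real.le_norm_self _).trans this) hsum)
  simp only [(hexp _).tsum_eq, MeasureTheory.integral_const_mul] at hint
  exact hint.tsum_eq.symm

theorem one_add_cpow_sub_isBigO (α : ℂ) (J : ℕ) :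
    (fun w : ℂ => (1 + w) ^ α - ∑ a ∈ range (J + 1), Ring.choose α a * w ^ a) =O[𝓝 0]
      fun w => ‖w‖ ^ (J + 1) := by
  have h := (Complex.one_add_cpow_hasFPowerSeriesAt_zero (a := α)).isBigO_sub_partialSum_pow (J + 1)
  refine h.congr_left fun w => ?_
  rw [zero_add, FormalMultilinearSeries.partialSum]
  congr 1
  refine sum_congr rfl fun a _ => ?_
  rw [binomialSeries_apply, List.ofFn_const, List.prod_replicate, smul_eq_mul]

open AddCircle in
theorem tendsto_weightedCoeff_div (p : ℤ) (n : ℕ) {q : ℤ} {J : ℕ} {X : ℂ}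
    (hX : ∀ δ : ℂ, ∑ a ∈ range (J + 1), ∑ b ∈ range (J + 1),
      Ring.choose (((n + p) / 2 : ℝ) : ℂ) a * Ring.choose (((n - p) / 2 : ℝ) : ℂ) b *
        δ ^ (a + b) * (Pi.single (a - b : ℤ) 1 : ℤ → ℂ) q = X * δ ^ J) :
    Tendsto (fun δ : ℝ => weightedCoeff p n δ q / (δ : ℂ) ^ J) (𝓝[>] 0) (𝓝 X) := by
  set α : ℂ := (((n + p) / 2 : ℝ) : ℂ)
  set β : ℂ := (((n - p) / 2 : ℝ) : ℂ)
  set A : ℂ → ℂ := fun w => ∑ a ∈ range (J + 1), Ring.choose α a * w ^ a with hA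
  set B : ℂ → ℂ := fun w => ∑ b ∈ range (J + 1), Ring.choose β b * w ^ b with hB
  have hAc : Continuous A := by fun_prop
  have hBc : Continuous B := by fun_prop
  have hconj : Tendsto (conj : ℂ → ℂ) (𝓝 0) (𝓝 0) := by
    simpa using Complex.continuous_conj.tendsto 0
  have hE : (fun w => (1 + w) ^ α * (1 + conj w) ^ β - A w * B (conj w)) =O[𝓝 0]
      fun w => ‖w‖ ^ (J + 1) := by
    have h1 := one_add_cpow_sub_isBigO α J
    have h2 : (fun w : ℂ => (1 + conj w) ^ β - B (conj w)) =O[𝓝 0] fun w => ‖w‖ ^ (J + 1) := by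
      have := (one_add_cpow_sub_isBigO β J).comp_tendsto hconj
      simpa [Function.comp_def] using this
    have h3 : (fun w : ℂ => (1 + conj w) ^ β) =O[𝓝 0] fun _ => (1 : ℝ) := by
      refine Tendsto.isBigO_one ℝ (c := (1 + conj (0 : ℂ)) ^ β) ?_
      refine ContinuousAt.tendsto (x := (0 : ℂ)) (f := fun w : ℂ => (1 + conj w) ^ β) ?_
      exact (continuous_const.add Complex.continuous_conj).continuousAt.cpow continuousAt_const
        (by simp)
    have h4 : A =O[𝓝 0] fun _ => (1 : ℝ) := (hAc.tendsto 0).isBigO_one ℝ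
    have h5 := (h1.mul h3).add (((h4.mul h2).congr_right fun w => mul_comm 1 _))
    refine (h5.congr_left fun w => ?_).congr_right fun w => by rw [mul_one]
    ring
  obtain ⟨C, hC0, hC⟩ := hE.exists_pos
  obtain ⟨ρ, hρ, hball⟩ := Metric.eventually_nhds_iff.1 hC.bound
  have hmain : ∀ δ : ℝ, 0 < δ → δ < 1 → δ < ρ →
      ‖weightedCoeff p n δ q / (δ : ℂ) ^ J - X‖ ≤ C * δ := fun δ hδ hδ1 hδρ => by
    set E : UnitAddCircle → ℂ := fun θ => weightedPow p n (1 + δ * fourier 1 θ) -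
      A (δ * fourier 1 θ) * B (δ * conj (fourier 1 θ : ℂ)) with hEdef
    have hbd : ∀ θ, ‖E θ‖ ≤ C * δ ^ (J + 1) := fun θ => by
      have hn := norm_mul_fourier hδ.le 1 θ
      have h := hball (y := δ * fourier 1 θ) (by rwa [dist_zero_right, hn])
      rw [hEdef]
      simp only
      rw [weightedPow_one_add (by rwa [hn])]
      rw [norm_pow, norm_norm, hn, map_mul, Complex.conj_ofReal] at h
      rwa [map_mul, Complex.conj_ofReal]
    have hfc := (fourier (T := 1) 1).continuous
    have hc1 : Continuous fun θ : UnitAddCircle => weightedPow p n (1 + δ * fourier 1 θ) :=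
      continuous_weightedPow p n (continuous_const.add (continuous_const.mul hfc)) fun θ =>
        one_add_mem_slitPlane (by rwa [norm_mul_fourier hδ.le])
    have hc2 : Continuous fun θ : UnitAddCircle =>
        A (δ * fourier 1 θ) * B (δ * conj (fourier 1 θ : ℂ)) :=
      (hAc.comp (continuous_const.mul hfc)).mul
        (hBc.comp (continuous_const.mul (Complex.continuous_conj.comp hfc)))
    have hsum : weightedCoeff p n δ q = fourierCoeff E q + X * δ ^ J := by
      have h1 := congrFun (fourierCoeff.add (f := E)
        (g := fun θ => A (δ * fourier 1 θ) * B (δ * conj (fourier 1 θ : ℂ)))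
        ((hc1.sub hc2).integrable_of_hasCompactSupport (HasCompactSupport.of_compactSpace _))
        (hc2.integrable_of_hasCompactSupport (HasCompactSupport.of_compactSpace _))) q
      rw [Pi.add_apply, hA, hB, fourierCoeff_sum_mul_sum, hX, ← hA, ← hB] at h1
      rw [← h1, weightedCoeff]
      congr 1
      ext θ
      simp [hEdef]
    have hδ0 : (δ : ℂ) ^ J ≠ 0 := pow_ne_zero _ (Complex.ofReal_ne_zero.2 hδ.ne')
    rw [hsum, add_div, mul_div_cancel_right₀ _ hδ0, add_sub_cancel_right, norm_div, norm_pow,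
      Complex.norm_real, Real.norm_of_nonneg hδ.le, div_le_iff₀ (by positivity), mul_assoc,
      ← pow_succ']
    exact norm_fourierCoeff_le hbd q
  rw [tendsto_iff_norm_sub_tendsto_zero]
  refine squeeze_zero' (Eventually.of_forall fun _ => norm_nonneg _) (g := fun δ => C * δ) ?_ ?_
  · filter_upwards [self_mem_nhdsWithin, nhdsWithin_le_nhds (Iio_mem_nhds one_pos),
      nhdsWithin_le_nhds (Iio_mem_nhds hρ)] with δ h1 h2 h3
    exact hmain δ h1 h2 h3
  · have : Tendsto (fun δ : ℝ => C * δ) (𝓝 0) (𝓝 (C * 0)) := tendsto_id.const_mul C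
    rw [mul_zero] at this
    exact this.mono_left nhdsWithin_le_nhds

theorem tendsto_weightedCoeff_natCast (p : ℤ) (n J : ℕ) :
    Tendsto (fun δ : ℝ => weightedCoeff p n δ J / (δ : ℂ) ^ J) (𝓝[>] 0)
      (𝓝 (Ring.choose (((n + p) / 2 : ℝ) : ℂ) J)) := by
  refine tendsto_weightedCoeff_div p n fun δ => ?_
  rw [sum_eq_single_of_mem J (self_mem_range_succ J), sum_eq_single_of_mem 0 (by simp)]
  · simp
  · intro b hb hb0
    rw [Pi.single_eq_of_ne (by omega), mul_zero]
  · intro a ha haJ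
    refine sum_eq_zero fun b hb => ?_
    rw [mem_range] at ha
    rw [Pi.single_eq_of_ne (by omega), mul_zero]

theorem tendsto_weightedCoeff_neg_natCast (p : ℤ) (n J : ℕ) :
    Tendsto (fun δ : ℝ => weightedCoeff p n δ (-J) / (δ : ℂ) ^ J) (𝓝[>] 0)
      (𝓝 (Ring.choose (((n - p) / 2 : ℝ) : ℂ) J)) := by
  refine tendsto_weightedCoeff_div p n fun δ => ?_
  rw [sum_eq_single_of_mem 0 (by simp), sum_eq_single_of_mem J (self_mem_range_succ J)]
  · simp
  · intro b hb hbJ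
    rw [Pi.single_eq_of_ne (by omega), mul_zero]
  · intro a ha ha0
    refine sum_eq_zero fun b hb => ?_
    rw [mem_range] at hb
    rw [Pi.single_eq_of_ne (by omega), mul_zero]

theorem exists_nat_of_choose_nonneg {α : ℝ} {n : ℕ} (hα : ∀ J ≥ n, 0 ≤ Ring.choose (α : ℂ) J) :
    ∃ j : ℕ, α = j := by
  by_contra! hne
  have hrec : ∀ J : ℕ, ((J : ℂ) + 1) * Ring.choose (α : ℂ) (J + 1) =
      ((α - J : ℝ) : ℂ) * Ring.choose (α : ℂ) J := fun J => by
    have h1 := Ring.descPochhammer_eq_factorial_smul_choose (α : ℂ) (J + 1)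
    rw [descPochhammer_succ_right, Polynomial.smeval_mul,
      Ring.descPochhammer_eq_factorial_smul_choose] at h1
    simp only [Polynomial.smeval_sub, Polynomial.smeval_X, Polynomial.smeval_natCast, pow_one,
      pow_zero, nsmul_eq_mul, mul_one, Nat.factorial_succ, Nat.cast_mul, Nat.cast_succ] at h1
    have h2 : (J.factorial : ℂ) ≠ 0 := Nat.cast_ne_zero.2 J.factorial_ne_zero
    apply mul_left_cancel₀ h2
    push_cast
    linear_combination -h1
  have hnz : ∀ J : ℕ, Ring.choose (α : ℂ) J ≠ 0 := fun J => by
    induction J with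
    | zero => simp
    | succ J ih =>
      intro h
      have h1 := hrec J
      rw [h, mul_zero, eq_comm, mul_eq_zero] at h1
      rcases h1 with h1 | h1
      · exact hne J (sub_eq_zero.1 (Complex.ofReal_eq_zero.1 h1))
      · exact ih h1
  obtain ⟨J, hJ⟩ := exists_nat_gt (max α n)
  have hJn : n ≤ J := by exact_mod_cast ((le_max_right α n).trans hJ.le)
  have hJα := (le_max_left α n).trans_lt hJ
  have h1 := congrArg Complex.re (hrec J)
  rw [Complex.re_ofReal_mul, ← Complex.ofReal_natCast, ← Complex.ofReal_one, ← Complex.ofReal_add,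
    Complex.re_ofReal_mul] at h1
  have h2 := Complex.pos_iff.1 ((hα J hJn).lt_of_ne (hnz J).symm)
  have h3 := Complex.nonneg_iff.1 (hα (J + 1) (hJn.trans J.le_succ))
  nlinarith [mul_nonneg (by positivity : (0 : ℝ) ≤ (J : ℝ) + 1) h3.1,
    mul_pos (sub_pos.2 hJα) h2.1]

theorem nonneg_of_tsum_mul_pow_nonneg {d : ℕ → ℂ} {n : ℕ} (hd : Summable fun m => ‖d m‖)
    (h0 : ∀ m < n, d m = 0) (h : ∀ r : ℝ, 0 < r → r < 1 → 0 ≤ ∑' m, d m * (r : ℂ) ^ m) :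
    0 ≤ d n := by
  have hlim : Tendsto (fun r : ℝ => ∑' m, d (m + n) * (r : ℂ) ^ m) (𝓝[>] 0)
      (𝓝 (∑' m, d (m + n) * (0 : ℂ) ^ m)) := by
    refine tendsto_tsum_of_dominated_convergence ((summable_nat_add_iff n).2 hd) (fun m => ?_) ?_
    · have hc : Continuous fun r : ℝ => d (m + n) * (r : ℂ) ^ m := by fun_prop
      have := hc.tendsto 0
      rw [Complex.ofReal_zero] at this
      exact this.mono_left nhdsWithin_le_nhds
    · filter_upwards [self_mem_nhdsWithin, nhdsWithin_le_nhds (Iio_mem_nhds one_pos)] with r h1 h2 m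
      rw [norm_mul, norm_pow, Complex.norm_real, Real.norm_of_nonneg (le_of_lt h1)]
      exact mul_le_of_le_one_right (norm_nonneg _) (pow_le_one₀ (le_of_lt h1) (le_of_lt h2))
  rw [tsum_eq_single 0 fun m hm => by rw [zero_pow hm, mul_zero], pow_zero, mul_one,
    zero_add] at hlim
  refine ge_of_tendsto hlim ?_
  filter_upwards [self_mem_nhdsWithin, nhdsWithin_le_nhds (Iio_mem_nhds one_pos)] with r h1 h2
  have hr : (0 : ℝ) < r ^ n := pow_pos h1 n
  have hsum : Summable fun m => d m * (r : ℂ) ^ m :=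
    Summable.of_norm_bounded hd fun m => by
      rw [norm_mul, norm_pow, Complex.norm_real, Real.norm_of_nonneg (le_of_lt h1)]
      exact mul_le_of_le_one_right (norm_nonneg _) (pow_le_one₀ (le_of_lt h1) (le_of_lt h2))
  have h3 : ∑' m, d m * (r : ℂ) ^ m = ((r ^ n : ℝ) : ℂ) * ∑' m, d (m + n) * (r : ℂ) ^ m := by
    rw [← hsum.sum_add_tsum_nat_add n, sum_eq_zero fun m hm => by
      rw [h0 m (mem_range.1 hm), zero_mul], zero_add, ← tsum_mul_left]
    refine tsum_congr fun m => ?_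
    push_cast
    ring
  exact le_of_mul_le_mul_left (by rw [mul_zero, ← h3]; exact h r h1 h2)
    (Complex.zero_lt_real.2 hr)

theorem GramPos.exists_eq_add_and_eq_sub {g : ℂ → ℂ} (hg : GramPos 3 g) (hc : Continuous g) {p : ℤ}
    {c : ℕ → ℝ} (hc0 : ∀ n, 0 ≤ c n)
    (hw : ∀ (z : ℂ) (τ : UnitAddCircle), g (z * fourier 1 τ) = fourier p τ * g z)
    (hs : ∀ r : ℝ, 0 ≤ r → HasSum (fun n => (c n : ℂ) * (r : ℂ) ^ n) (g r)) (n : ℕ)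
    (hn : c n ≠ 0) : ∃ j k : ℕ, n = j + k ∧ p = j - k := by
  induction n using Nat.strong_induction_on with
  | _ n ih =>
    have hsum : Summable fun m => c m * 2 ^ m := by
      have := (hs 2 (by norm_num)).summable
      exact_mod_cast this
    have hW : ∀ (q : ℤ) (δ : ℝ), n ≤ |q| → 0 ≤ δ → δ < 1 → 0 ≤ weightedCoeff p n δ q :=
      fun q δ hq hδ hδ1 => by
        have h := nonneg_of_tsum_mul_pow_nonneg (d := fun m => c m * weightedCoeff p m δ q) (n := n)
          (Summable.of_nonneg_of_le (fun m => norm_nonneg _) (fun m => by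
            rw [norm_mul, Complex.norm_real, Real.norm_of_nonneg (hc0 m)]
            exact mul_le_mul_of_nonneg_left (norm_weightedCoeff_le p m hδ hδ1 q) (hc0 m)) hsum)
          (fun m hm => by
            by_cases hcm : c m = 0
            · rw [hcm, Complex.ofReal_zero, zero_mul]
            · obtain ⟨j, k, rfl, rfl⟩ := ih m hm hcm
              rw [weightedCoeff_eq_zero j k δ (by omega), mul_zero])
          (fun r hr _ => by
            have h := hg.weighted_tsum_nonneg hc hc0 hw hs hr hδ hδ1 q
            simpa only [mul_right_comm] using h)
        exact le_of_mul_le_mul_left (by rwa [mul_zero])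
          (Complex.zero_lt_real.2 ((hc0 n).lt_of_ne hn.symm))
    have hlim : ∀ (q : ℤ) (J : ℕ) (X : ℂ), n ≤ |q| →
        Tendsto (fun δ : ℝ => weightedCoeff p n δ q / (δ : ℂ) ^ J) (𝓝[>] 0) (𝓝 X) → 0 ≤ X :=
      fun q J X hq h => by
        refine ge_of_tendsto h ?_
        filter_upwards [self_mem_nhdsWithin, nhdsWithin_le_nhds (Iio_mem_nhds one_pos)]
          with δ h1 h2
        rw [div_eq_mul_inv, ← Complex.ofReal_pow, ← Complex.ofReal_inv]
        exact mul_nonneg (hW q δ hq (le_of_lt h1) h2)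
          (Complex.zero_le_real.2 (inv_nonneg.2 (pow_nonneg (le_of_lt h1) J)))
    obtain ⟨j, hj⟩ := exists_nat_of_choose_nonneg (n := n) fun J hJ =>
      hlim J J _ (by simpa using hJ) (tendsto_weightedCoeff_natCast p n J)
    obtain ⟨k, hk⟩ := exists_nat_of_choose_nonneg (n := n) fun J hJ =>
      hlim (-J) J _ (by simpa using hJ) (tendsto_weightedCoeff_neg_natCast p n J)
    refine ⟨j, k, ?_, ?_⟩
    · have : (n : ℝ) = j + k := by linarith
      exact_mod_cast this
    · have : (p : ℝ) = j - k := by linarith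
      exact_mod_cast this

theorem injective_sub_add : Function.Injective fun jk : ℕ × ℕ => ((jk.1 - jk.2 : ℤ), jk.1 + jk.2) :=
  fun ⟨a, b⟩ ⟨a', b'⟩ h => by
    simp only [Prod.mk.injEq] at h ⊢
    omega

theorem FmC.exists_hasSum {m : ℕ} (hm : 3 ≤ m) {f : ℂ → ℂ} (hf : FmC m f) :
    ∃ b : ℕ × ℕ → ℝ, (∀ r : ℝ, 0 ≤ r → Summable fun jk => |b jk| * r ^ (jk.1 + jk.2)) ∧
      ∀ z, HasSum (fun jk => (b jk : ℂ) * (z ^ jk.1 * conj z ^ jk.2)) (f z) := by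
  have hfc := hf.continuous hm
  have hg : ∀ p, GramPos 3 (rotComponent f p) := fun p => (hf.gramPos hm).rotComponent hfc p
  choose c hc0 hs using fun p => (hg p).exists_hasSum (continuous_rotComponent hfc p)
  have hb : ∀ r : ℝ, 0 ≤ r → Summable fun jk : ℕ × ℕ =>
      |c (jk.1 - jk.2) (jk.1 + jk.2)| * r ^ (jk.1 + jk.2) := fun r hr => by
    have hgeo : Summable fun jk : ℕ × ℕ => (1 / 2 : ℝ) ^ jk.1 * (1 / 2) ^ jk.2 :=
      summable_geometric_two.mul_of_nonneg summable_geometric_two (fun _ => by positivity)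
        fun _ => by positivity
    refine Summable.of_nonneg_of_le (fun jk => by positivity) (fun jk => ?_)
      (hgeo.mul_left (f ((2 * r : ℝ) : ℂ)).re)
    have h1 := Complex.hasSum_re (hs (jk.1 - jk.2) (2 * r) (by positivity))
    simp only [← Complex.ofReal_pow, ← Complex.ofReal_mul, Complex.ofReal_re] at h1
    have h2 := le_hasSum h1 (jk.1 + jk.2) fun n _ => mul_nonneg (hc0 _ n) (by positivity)
    have h3 := h2.trans ((Complex.re_le_norm _).trans
      (hf.norm_rotComponent_le hm (jk.1 - jk.2) (by positivity : 0 ≤ 2 * r)))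
    rw [← pow_add, abs_of_nonneg (hc0 _ _)]
    calc c (jk.1 - jk.2) (jk.1 + jk.2) * r ^ (jk.1 + jk.2)
        = c (jk.1 - jk.2) (jk.1 + jk.2) * (2 * r) ^ (jk.1 + jk.2) * (1 / 2) ^ (jk.1 + jk.2) := by
          rw [mul_assoc, ← mul_pow]
          ring_nf
      _ ≤ _ := mul_le_mul_of_nonneg_right h3 (by positivity)
  refine ⟨fun jk => c (jk.1 - jk.2) (jk.1 + jk.2), hb, fun z => ?_⟩
  have hsum : Summable fun jk : ℕ × ℕ =>
      (c (jk.1 - jk.2) (jk.1 + jk.2) : ℂ) * (z ^ jk.1 * conj z ^ jk.2) := by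
    refine Summable.of_norm ((hb ‖z‖ (norm_nonneg z)).congr fun jk => ?_)
    rw [norm_mul, norm_mul, norm_pow, norm_pow, Complex.norm_conj, Complex.norm_real,
      Real.norm_eq_abs, pow_add]
  obtain ⟨S, hS⟩ := hsum
  have hS' : HasSum (fun pn : ℤ × ℕ => (c pn.1 pn.2 : ℂ) * weightedPow pn.1 pn.2 z) S := by
    rw [← injective_sub_add.hasSum_iff]
    · simpa only [Function.comp_def, weightedPow_eq_mul_conj] using hS
    · rintro ⟨p, n⟩ hpn
      by_contra h
      have hn : c p n ≠ 0 := fun hn => h (by rw [hn, Complex.ofReal_zero, zero_mul])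
      obtain ⟨j, k, rfl, rfl⟩ := (hg p).exists_eq_add_and_eq_sub (continuous_rotComponent hfc p)
        (hc0 p) (rotComponent_mul_fourier f p) (hs p) n hn
      exact hpn ⟨(j, k), rfl⟩
  have hp := hS'.prod_fiberwise fun p => hasSum_weightedPow (rotComponent_mul_fourier f p) (hs p) z
  have hF := has_pointwise_sum_fourier_series_of_summable
    (f := (⟨_, continuous_mul_fourier hfc z⟩ : C(UnitAddCircle, ℂ))) hp.summable 0
  simp only [ContinuousMap.coe_mk, fourier_eval_zero, smul_eq_mul, mul_one] at hF
  rwa [← hp.unique hF]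

theorem sum_antidiagonal_product_choose_mul {R : Type*} [CommSemiring R] (s t u v : R)
    (jk : ℕ × ℕ) :
    ∑ ab ∈ antidiagonal jk.1 ×ˢ antidiagonal jk.2,
      ((ab.1.1 + ab.1.2).choose ab.1.1 * (ab.2.1 + ab.2.2).choose ab.2.1 : R) *
        ((s ^ ab.1.1 * t ^ ab.1.2) * (u ^ ab.2.1 * v ^ ab.2.2)) =
      (s + t) ^ jk.1 * (u + v) ^ jk.2 := by
  rw [(Commute.all s t).add_pow', (Commute.all u v).add_pow', sum_mul_sum, ← sum_product']
  refine sum_congr rfl fun ab hab => ?_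
  simp only [mem_product, HasAntidiagonal.mem_antidiagonal] at hab
  rw [hab.1, hab.2, nsmul_eq_mul, nsmul_eq_mul]
  ring

theorem tsum_preimage_add_add {E : Type*} [AddCommMonoid E] [TopologicalSpace E]
    (T : (ℕ × ℕ) × ℕ × ℕ → E) (jk : ℕ × ℕ) :
    ∑' ab : (fun ab : (ℕ × ℕ) × ℕ × ℕ => (ab.1.1 + ab.1.2, ab.2.1 + ab.2.2)) ⁻¹' {jk}, T ab =
      ∑ ab ∈ antidiagonal jk.1 ×ˢ antidiagonal jk.2, T ab := by
  have h : (fun ab : (ℕ × ℕ) × ℕ × ℕ => (ab.1.1 + ab.1.2, ab.2.1 + ab.2.2)) ⁻¹' {jk} =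
      (antidiagonal jk.1 ×ˢ antidiagonal jk.2 : Finset ((ℕ × ℕ) × ℕ × ℕ)) := by
    ext ab
    simp [Prod.ext_iff]
  rw [h, Finset.tsum_subtype']

theorem summable_iff_antidiagonal_product {T : (ℕ × ℕ) × ℕ × ℕ → ℝ} (hT : 0 ≤ T) :
    Summable T ↔
      Summable fun jk : ℕ × ℕ => ∑ ab ∈ antidiagonal jk.1 ×ˢ antidiagonal jk.2, T ab := by
  rw [summable_partition hT (s := fun jk : ℕ × ℕ =>
    (fun ab : (ℕ × ℕ) × ℕ × ℕ => (ab.1.1 + ab.1.2, ab.2.1 + ab.2.2)) ⁻¹' {jk})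
    fun ab => ⟨_, rfl, fun _ h => h.symm⟩]
  simp only [tsum_preimage_add_add]
  refine and_iff_right fun jk => ?_
  have : Finite ((fun ab : (ℕ × ℕ) × ℕ × ℕ => (ab.1.1 + ab.1.2, ab.2.1 + ab.2.2)) ⁻¹' {jk}) := by
    refine (antidiagonal jk.1 ×ˢ antidiagonal jk.2).finite_toSet.subset fun ab hab => ?_
    simpa [Prod.ext_iff] using hab
  exact Summable.of_finite

theorem HasSum.antidiagonal_product {E : Type*} [AddCommGroup E] [UniformSpace E]
    [IsUniformAddGroup E] [CompleteSpace E] [T2Space E] {T : (ℕ × ℕ) × ℕ × ℕ → E} {S : E}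
    (h : HasSum T S) :
    HasSum (fun jk : ℕ × ℕ => ∑ ab ∈ antidiagonal jk.1 ×ˢ antidiagonal jk.2, T ab) S := by
  simpa only [tsum_preimage_add_add] using
    h.tsum_fiberwise fun ab : (ℕ × ℕ) × ℕ × ℕ => (ab.1.1 + ab.1.2, ab.2.1 + ab.2.2)

theorem exists_hasSum_real_pow {b : ℕ × ℕ → ℝ} {f : ℂ → ℂ}
    (hb : ∀ r : ℝ, 0 ≤ r → Summable fun jk => |b jk| * r ^ (jk.1 + jk.2))
    (hf : ∀ z, HasSum (fun jk => (b jk : ℂ) * (z ^ jk.1 * conj z ^ jk.2)) (f z)) :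
    ∃ C : ℕ × ℕ → ℂ, ∀ x y : ℝ,
      HasSum (fun kl : ℕ × ℕ => C kl * ((x ^ kl.1 * y ^ kl.2 : ℝ) : ℂ))
        (f (x + y * Complex.I)) := by
  set A : (ℕ × ℕ) × ℕ × ℕ → ℂ := fun ab => b (ab.1.1 + ab.1.2, ab.2.1 + ab.2.2) *
    ((ab.1.1 + ab.1.2).choose ab.1.1 * (ab.2.1 + ab.2.2).choose ab.2.1) *
      (Complex.I ^ ab.1.2 * (-Complex.I) ^ ab.2.2) with hA
  refine ⟨fun kl => ∑ ab ∈ antidiagonal kl.1 ×ˢ antidiagonal kl.2,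
    A (Equiv.prodProdProdComm _ _ _ _ ab), fun x y => ?_⟩
  set T : (ℕ × ℕ) × ℕ × ℕ → ℂ := fun ab =>
    A ab * ((x ^ (ab.1.1 + ab.2.1) * y ^ (ab.1.2 + ab.2.2) : ℝ) : ℂ) with hT
  have hTsum : Summable T := by
    refine Summable.of_norm ((summable_iff_antidiagonal_product fun _ => norm_nonneg _).2
      ((hb (|x| + |y|) (by positivity)).congr fun jk => ?_))
    rw [pow_add, ← sum_antidiagonal_product_choose_mul, mul_sum]
    refine sum_congr rfl fun ab hab => ?_
    simp only [mem_product, HasAntidiagonal.mem_antidiagonal] at hab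
    simp only [hT, hA, norm_mul, norm_pow, norm_neg, Complex.norm_I, one_pow, mul_one,
      Complex.norm_real, Real.norm_eq_abs, Complex.norm_natCast, hab.1, hab.2]
    ring
  obtain ⟨S, hS⟩ := hTsum
  have h1 : S = f (x + y * Complex.I) := by
    refine hS.antidiagonal_product.unique ?_
    have h2 : ∀ jk : ℕ × ℕ, ∑ ab ∈ antidiagonal jk.1 ×ˢ antidiagonal jk.2, T ab =
        b jk * ((x + y * Complex.I) ^ jk.1 * conj (x + y * Complex.I) ^ jk.2) := fun jk => by
      have h3 : conj (x + y * Complex.I) = x + y * -Complex.I := by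
        rw [map_add, map_mul, Complex.conj_ofReal, Complex.conj_ofReal, Complex.conj_I]
      rw [h3, ← sum_antidiagonal_product_choose_mul, mul_sum]
      refine sum_congr rfl fun ab hab => ?_
      simp only [mem_product, HasAntidiagonal.mem_antidiagonal] at hab
      simp only [hT, hA, hab.1, hab.2]
      push_cast
      ring
    simp only [h2]
    exact hf _
  rw [← h1]
  have h2 := ((Equiv.prodProdProdComm ℕ ℕ ℕ ℕ).hasSum_iff.2 hS).antidiagonal_product
  have h3 : ∀ kl : ℕ × ℕ, (∑ ab ∈ antidiagonal kl.1 ×ˢ antidiagonal kl.2,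
      A (Equiv.prodProdProdComm _ _ _ _ ab)) * ((x ^ kl.1 * y ^ kl.2 : ℝ) : ℂ) =
      ∑ ab ∈ antidiagonal kl.1 ×ˢ antidiagonal kl.2,
        (T ∘ Equiv.prodProdProdComm ℕ ℕ ℕ ℕ) ab := fun kl => by
    rw [sum_mul]
    refine sum_congr rfl fun ab hab => ?_
    simp only [mem_product, HasAntidiagonal.mem_antidiagonal] at hab
    rw [← hab.1, ← hab.2]
    rfl
  simpa only [h3] using h2

end

theorem stmt_11 (m : ℕ) (hm : 3 ≤ m) (f : ℂ → ℂ) (hf : FmC m f) :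
    ∃ c : ℕ × ℕ → ℝ, ∀ x y : ℝ,
      Summable (fun kl : ℕ × ℕ => |c kl * x ^ kl.1 * y ^ kl.2|) ∧
      HasSum (fun kl : ℕ × ℕ => c kl * x ^ kl.1 * y ^ kl.2)
        ((f ((x : ℂ) + (y : ℂ) * Complex.I)).im) := by
  obtain ⟨b, hb, hs⟩ := hf.exists_hasSum hm
  obtain ⟨C, hC⟩ := exists_hasSum_real_pow hb hs
  have h : ∀ x y : ℝ, HasSum (fun kl : ℕ × ℕ => (C kl).im * x ^ kl.1 * y ^ kl.2)
      ((f ((x : ℂ) + (y : ℂ) * Complex.I)).im) := fun x y => by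
    simpa only [Complex.im_mul_ofReal, mul_assoc] using Complex.hasSum_im (hC x y)
  exact ⟨fun kl => (C kl).im, fun x y => ⟨(h x y).summable.abs, h x y⟩⟩
end

section
/- Let H be a nontrivial complex inner product space and let f : ℂ → ℂ be of form (3.1). Then f is strictly Hermitian positive definite on H if and only if f is strictly Hermitian positive definite on ℂ equipped with the standard inner product ⟨z, w⟩ = z·conj(w); that is, if and only if for every n ∈ ℕ, all pairwise distinct z_1,...,z_n ∈ ℂ, the matrix (f(z_r conj(z_s)))_{r,s=1}^n is Hermitian positive definite. -/
open ComplexConjugate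
open scoped ComplexOrder InnerProductSpace

/-- A function `f : ℂ → ℂ` is of form (3.1): there exist nonnegative reals `b (k,ℓ)`
such that for every `z ∈ ℂ` the family `b (k,ℓ) * z^k * conj z ^ ℓ` is summable with sum `f z`. -/
def Form31 (f : ℂ → ℂ) : Prop :=
  ∃ b : ℕ × ℕ → ℝ, (∀ kl, 0 ≤ b kl) ∧
    ∀ z : ℂ, HasSum (fun kl : ℕ × ℕ => (b kl : ℂ) * z ^ kl.1 * (conj z) ^ kl.2) (f z)

/-- `f` is strictly Hermitian positive definite on `H`: for all `n` and pairwise distinct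
`z 1, …, z n` in `H`, the matrix `(f ⟨z r, z s⟩)` is Hermitian positive definite.  The paper's
inner product `⟨x, y⟩` is linear in the first argument, so it is `⟪y, x⟫_ℂ` in Mathlib's
convention. -/
def StrictHPDOn (H : Type*) [NormedAddCommGroup H] [InnerProductSpace ℂ H] (f : ℂ → ℂ) : Prop :=
  ∀ (n : ℕ) (z : Fin n → H), Function.Injective z →
    (Matrix.of fun r s : Fin n => f ⟪z s, z r⟫_ℂ).PosDef

open scoped Matrix

namespace Matrix

/-- Entrywise natural powers of a positive semidefinite matrix are positive semidefinite. -/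
theorem PosSemidef.map_pow {n : Type*} [Finite n] {A : Matrix n n ℂ} (hA : A.PosSemidef) (k : ℕ) :
    (A.map (· ^ k)).PosSemidef := by
  induction k with
  | zero =>
    convert posSemidef_vecMulVec_self_star (fun _ : n => (1 : ℂ)) using 1
    ext r s
    simp [vecMulVec_apply]
  | succ k ih =>
    have h : A.map (· ^ (k + 1)) = A.map (· ^ k) ⊙ A := by
      ext r s
      simp [hadamard_apply, pow_succ]
    exact h ▸ ih.hadamard hA

theorem posSemidef_inner_pow {E n : Type*} [NormedAddCommGroup E] [InnerProductSpace ℂ E]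
    [Finite n] (v : n → E) (k l : ℕ) :
    (of fun r s => ⟪v s, v r⟫_ℂ ^ k * conj ⟪v s, v r⟫_ℂ ^ l).PosSemidef := by
  have h : (of fun r s => ⟪v s, v r⟫_ℂ ^ k * conj ⟪v s, v r⟫_ℂ ^ l) =
      (gram ℂ v)ᵀ.map (· ^ k) ⊙ (gram ℂ v).map (· ^ l) := by
    ext r s
    simp [hadamard_apply, gram_apply]
  exact h ▸ ((posSemidef_gram ℂ v).transpose.map_pow k).hadamard
    ((posSemidef_gram ℂ v).map_pow l)

end Matrix

/-- If the quadratic form of the kernel `⟪y, x⟫ ^ k * conj ⟪y, x⟫ ^ l` at the points `v` vanishes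
at `c`, then so does the function `u ↦ ∑ s, c s * ⟪v s, u⟫ ^ k * conj ⟪v s, u⟫ ^ l`. -/
theorem sum_inner_pow_eq_zero {E n : Type*} [NormedAddCommGroup E] [InnerProductSpace ℂ E]
    [Fintype n] (v : n → E) (k l : ℕ) (c : n → ℂ)
    (hc : star c ⬝ᵥ ((Matrix.of fun r s => ⟪v s, v r⟫_ℂ ^ k * conj ⟪v s, v r⟫_ℂ ^ l) *ᵥ c) = 0)
    (u : E) :
    ∑ s, ⟪v s, u⟫_ℂ ^ k * conj ⟪v s, u⟫_ℂ ^ l * c s = 0 := by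
  have hK := Matrix.posSemidef_inner_pow (fun o : Option n => o.elim u v) k l
  have h := (hK.dotProduct_mulVec_zero_iff (fun o : Option n => o.elim 0 c)).1 (by
    refine Eq.trans ?_ hc
    simp [Matrix.mulVec, dotProduct, Fintype.sum_option])
  simpa [Matrix.mulVec, dotProduct, Fintype.sum_option] using congrFun h none

/-- Finitely many distinct vectors are separated by the inner product with a single vector. -/
theorem exists_injective_inner {E n : Type*} [NormedAddCommGroup E] [InnerProductSpace ℂ E]
    [Finite n] (v : n → E) (hv : Function.Injective v) :
    ∃ u : E, Function.Injective fun r => ⟪u, v r⟫_ℂ := by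
  obtain ⟨u, hu⟩ := Submodule.exists_forall_notMem_of_forall_ne_top
    (fun p : {p : n × n // p.1 ≠ p.2} => (ℂ ∙ (v p.1.1 - v p.1.2))ᗮ) (by
      rintro ⟨⟨r, s⟩, hrs⟩ h
      rw [Submodule.orthogonal_eq_top_iff, Submodule.span_singleton_eq_bot, sub_eq_zero] at h
      exact hrs (hv h))
  refine ⟨u, fun r s h => by_contra fun hrs => hu ⟨(r, s), hrs⟩ ?_⟩
  rw [Submodule.mem_orthogonal_singleton_iff_inner_left, inner_sub_right, sub_eq_zero]
  exact h

theorem Form31.map_conj {f : ℂ → ℂ} (hf : Form31 f) (z : ℂ) : f (conj z) = conj (f z) := by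
  obtain ⟨b, -, hb⟩ := hf
  refine (hb (conj z)).unique ?_
  convert Complex.hasSum_conj'.2 (hb z) using 2 with kl
  simp

theorem hasSum_mulVec {ι m n : Type*} [Fintype n] {A : ι → Matrix m n ℂ} {B : Matrix m n ℂ}
    (h : ∀ r s, HasSum (fun i => A i r s) (B r s)) (c : n → ℂ) (r : m) :
    HasSum (fun i => (A i *ᵥ c) r) ((B *ᵥ c) r) :=
  hasSum_sum fun s _ => (h r s).mul_right (c s)

theorem strictHPDOn_of_complex {H : Type*} [NormedAddCommGroup H] [InnerProductSpace ℂ H]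
    {f : ℂ → ℂ} (hf : Form31 f)
    (h : ∀ (n : ℕ) (z : Fin n → ℂ), Function.Injective z →
      (Matrix.of fun r s : Fin n => f (z r * conj (z s))).PosDef) :
    StrictHPDOn H f := by
  intro n z hz
  refine .of_dotProduct_mulVec_pos ?_ fun c hc => ?_
  · ext r s
    simp [← hf.map_conj]
  obtain ⟨b, hb0, hb⟩ := hf
  let K : ℕ × ℕ → Matrix (Fin n) (Fin n) ℂ := fun kl =>
    .of fun r s => ⟪z s, z r⟫_ℂ ^ kl.1 * conj ⟪z s, z r⟫_ℂ ^ kl.2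
  have hK : ∀ kl, (K kl).PosSemidef := fun kl => Matrix.posSemidef_inner_pow z kl.1 kl.2
  have hsum : HasSum (fun kl => (b kl : ℂ) * (star c ⬝ᵥ (K kl *ᵥ c)))
      (star c ⬝ᵥ ((Matrix.of fun r s => f ⟪z s, z r⟫_ℂ) *ᵥ c)) := by
    have := hasSum_sum (s := Finset.univ) fun r _ => (hasSum_mulVec
      (A := fun kl => (b kl : ℂ) • K kl) (B := .of fun r s => f ⟪z s, z r⟫_ℂ)
      (fun r s => by simpa [K, mul_assoc] using hb ⟪z s, z r⟫_ℂ) c r).mul_left (star c r)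
    refine (congrArg (HasSum · _) (funext fun kl => ?_)).mpr this
    rw [← smul_eq_mul, ← dotProduct_smul, ← Matrix.smul_mulVec]
    rfl
  have hnonneg : ∀ kl, 0 ≤ (b kl : ℂ) * (star c ⬝ᵥ (K kl *ᵥ c)) := fun kl =>
    mul_nonneg (by exact_mod_cast hb0 kl) ((hK kl).dotProduct_mulVec_nonneg c)
  refine (hsum.nonneg hnonneg).lt_of_ne' fun h0 => ?_
  rw [h0, hasSum_zero_iff_of_nonneg hnonneg] at hsum
  obtain ⟨u, hu⟩ := exists_injective_inner z hz
  refine ((h n _ hu).dotProduct_mulVec_pos hc).ne' ?_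
  suffices hw : (Matrix.of fun r s => f (⟪u, z r⟫_ℂ * conj ⟪u, z s⟫_ℂ)) *ᵥ c = 0 by
    rw [hw, dotProduct_zero]
  ext r
  refine (hasSum_mulVec (A := fun kl => .of fun r s => (b kl : ℂ) *
    (⟪u, z r⟫_ℂ * conj ⟪u, z s⟫_ℂ) ^ kl.1 * conj (⟪u, z r⟫_ℂ * conj ⟪u, z s⟫_ℂ) ^ kl.2)
    (fun r s => hb _) c r).unique ?_
  refine (congrArg (HasSum · _) (funext fun kl => ?_)).mpr hasSum_zero
  rcases mul_eq_zero.1 (congrFun hsum kl) with hbk | hbk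
  · simp [Matrix.mulVec, dotProduct, hbk]
  · have := sum_inner_pow_eq_zero z kl.1 kl.2 c hbk u
    calc _ = (b kl : ℂ) * ⟪u, z r⟫_ℂ ^ kl.1 * conj ⟪u, z r⟫_ℂ ^ kl.2 *
          ∑ s, ⟪z s, u⟫_ℂ ^ kl.1 * conj ⟪z s, u⟫_ℂ ^ kl.2 * c s := by
          rw [Finset.mul_sum]
          simp only [Matrix.mulVec, dotProduct]
          refine Finset.sum_congr rfl fun s _ => ?_
          simp only [Matrix.of_apply, map_mul, inner_conj_symm]
          ring
      _ = 0 := by rw [this, mul_zero]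

theorem stmt_13 {H : Type*} [NormedAddCommGroup H] [InnerProductSpace ℂ H] [Nontrivial H]
    (f : ℂ → ℂ) (hf : Form31 f) :
    StrictHPDOn H f ↔
      ∀ (n : ℕ) (z : Fin n → ℂ), Function.Injective z →
        (Matrix.of fun r s : Fin n => f (z r * conj (z s))).PosDef := by
  refine ⟨fun h n z hz => ?_, strictHPDOn_of_complex hf⟩
  obtain ⟨e, he⟩ := exists_norm_eq H zero_le_one
  have he0 : e ≠ 0 := norm_ne_zero_iff.1 (by simp [he])
  have hz' : ∀ r s, ⟪z s • e, z r • e⟫_ℂ = z r * conj (z s) := fun r s => by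
    simp [he]
  simpa only [Function.comp_apply, hz'] using
    h n _ ((smul_left_injective ℂ he0).comp hz)
end

section
/- Let H be a complex inner product space and let z¹,...,zⁿ be n pairwise distinct points of H. Then there exist pairwise distinct complex numbers z_1,...,z_n and an n×n complex Hermitian positive semidefinite matrix (m_{rs})_{r,s=1}^n such that ⟨z^r, z^s⟩ = z_r·conj(z_s) + m_{rs} for all r, s ∈ {1,...,n}. -/
open ComplexConjugate
open scoped ComplexOrder InnerProductSpace

/-- Finitely many nonzero vectors admit a common vector `e`, either a unit vector or zero,
which is orthogonal to none of them. -/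
lemma exists_forall_inner_ne_zero {H ι : Type*} [NormedAddCommGroup H] [InnerProductSpace ℂ H]
    [Finite ι] (v : ι → H) (hv : ∀ i, v i ≠ 0) :
    ∃ e : H, (e = 0 ∨ ‖e‖ = 1) ∧ ∀ i, ⟪e, v i⟫_ℂ ≠ 0 := by
  obtain ⟨e, he⟩ := Module.Dual.exists_forall_ne_zero_of_forall_exists
    (fun i ↦ (innerSL ℂ (v i)).toLinearMap) fun i ↦ ⟨v i, by simpa using hv i⟩
  have he' : ∀ i, ⟪e, v i⟫_ℂ ≠ 0 := fun i h ↦ he i (by simpa using inner_eq_zero_symm.mp h)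
  rcases eq_or_ne e 0 with rfl | h0
  · exact ⟨0, .inl rfl, he'⟩
  · refine ⟨((‖e‖⁻¹ : ℝ) : ℂ) • e, .inr ?_, fun i ↦ ?_⟩
    · simp [norm_smul, h0]
    · rw [inner_smul_left]
      exact mul_ne_zero (by simpa using h0) (he' i)

/-- The inner product splits into the parts along `e` and orthogonal to `e`. -/
lemma inner_eq_mul_conj_add_inner_sub {H : Type*} [NormedAddCommGroup H] [InnerProductSpace ℂ H]
    {e : H} (he : e = 0 ∨ ‖e‖ = 1) (x y : H) :
    ⟪y, x⟫_ℂ = ⟪e, x⟫_ℂ * conj ⟪e, y⟫_ℂ + ⟪y - ⟪e, y⟫_ℂ • e, x - ⟪e, x⟫_ℂ • e⟫_ℂ := by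
  rcases he with rfl | he
  · simp
  · have h1 : ⟪e, e⟫_ℂ = 1 := by simp [inner_self_eq_norm_sq_to_K, he]
    simp only [inner_sub_left, inner_sub_right, inner_smul_left, inner_smul_right, h1,
      inner_conj_symm]
    ring

/-- The paper's inner product `⟨x, y⟩` is linear in the first argument, i.e. it is
`⟪y, x⟫_ℂ` in Mathlib's convention. -/
theorem stmt_14 {H : Type*} [NormedAddCommGroup H] [InnerProductSpace ℂ H]
    (n : ℕ) (z : Fin n → H) (hz : Function.Injective z) :
    ∃ (w : Fin n → ℂ) (M : Matrix (Fin n) (Fin n) ℂ), Function.Injective w ∧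
      M.PosSemidef ∧ ∀ r s : Fin n, ⟪z s, z r⟫_ℂ = w r * conj (w s) + M r s := by
  obtain ⟨e, he, hne⟩ := exists_forall_inner_ne_zero
    (fun p : {p : Fin n × Fin n // p.1 ≠ p.2} ↦ z p.1.1 - z p.1.2)
    fun p ↦ sub_ne_zero.mpr (hz.ne p.2)
  refine ⟨fun r ↦ ⟪e, z r⟫_ℂ, (Matrix.gram ℂ fun r ↦ z r - ⟪e, z r⟫_ℂ • e).transpose, ?_,
    (Matrix.posSemidef_gram ℂ _).transpose, fun r s ↦ inner_eq_mul_conj_add_inner_sub he _ _⟩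
  intro r s hrs
  by_contra h
  exact hne ⟨(r, s), h⟩ (by rw [inner_sub_right]; exact sub_eq_zero.mpr hrs)
end

section
/- Let f : ℂ → ℂ be of form (3.1) with coefficients b_{k,ℓ} ≥ 0 and set J = {(k,ℓ) ∈ ℕ×ℕ : b_{k,ℓ} > 0}. If for every n ∈ ℕ and all pairwise distinct z_1,...,z_n ∈ ℂ the matrix (f(z_r conj(z_s)))_{r,s=1}^n is Hermitian positive definite, then (0,0) ∈ J and for every integer p ≥ 1 and every q ∈ {0, 1, ..., p−1} the set {k−ℓ : (k,ℓ) ∈ J, k−ℓ ≡ q (mod p)} ⊆ ℤ is infinite. -/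
open ComplexConjugate
open scoped ComplexOrder

/-- The powers of a primitive `N`-th root of unity `ω` with exponents in an arithmetic progression
of difference `e` sum to zero over a period, unless `N ∣ e`. -/
theorem IsPrimitiveRoot.sum_zpow_pow_eq_zero {K : Type*} [Field K] {ω : K} {N : ℕ}
    (hω : IsPrimitiveRoot ω N) {e : ℤ} (he : ¬ (N : ℤ) ∣ e) :
    ∑ s : Fin N, (ω ^ e) ^ (s : ℕ) = 0 := by
  have hx : ω ^ e ≠ 1 := fun h => he ((hω.zpow_eq_one_iff_dvd e).1 h)
  rw [Fin.sum_univ_eq_sum_range (fun s => (ω ^ e) ^ s), geom_sum_eq hx, ← zpow_natCast,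
    ← zpow_mul, mul_comm, zpow_mul, zpow_natCast, hω.pow_eq_one, one_zpow, sub_self, zero_div]

/-- If all matrices `f (z r * conj (z s))` are positive definite, then every residue class is met
by a difference `k - l` of exponents in the support of the expansion of `f`. -/
theorem exists_pos_coeff_sub_modEq (f : ℂ → ℂ) (b : ℕ × ℕ → ℝ) (hb : ∀ kl, 0 ≤ b kl)
    (hf : ∀ z : ℂ, HasSum (fun kl : ℕ × ℕ => (b kl : ℂ) * z ^ kl.1 * (conj z) ^ kl.2) (f z))
    (hpd : ∀ (n : ℕ) (z : Fin n → ℂ), Function.Injective z →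
      (Matrix.of fun r s : Fin n => f (z r * conj (z s))).PosDef)
    (N : ℕ) (hN : N ≠ 0) (a : ℤ) :
    ∃ kl, 0 < b kl ∧ (N : ℤ) ∣ a - ((kl.1 : ℤ) - (kl.2 : ℤ)) := by
  by_contra! hno
  obtain ⟨ω, hω⟩ : ∃ ω : ℂ, IsPrimitiveRoot ω N := ⟨_, Complex.isPrimitiveRoot_exp N hN⟩
  have hω0 : ω ≠ 0 := hω.ne_zero hN
  have hconj : conj ω = ω⁻¹ := (Complex.inv_eq_conj (hω.norm'_eq_one hN)).symm
  have hpos := hpd N (fun r => ω ^ (r : ℕ))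
    (fun r s h => Fin.ext (hω.pow_inj r.2 s.2 h))
  set c : Fin N → ℂ := fun s => (ω ^ a) ^ (s : ℕ) with hc
  have hc0 : c ≠ 0 := fun h => by
    have := congrFun h ⟨0, Nat.pos_of_ne_zero hN⟩
    simp [hc] at this
  have hker : (Matrix.of fun r s : Fin N =>
      f (ω ^ (r : ℕ) * conj (ω ^ (s : ℕ)))).mulVec c = 0 := by
    funext r
    have hsum := hasSum_sum (s := Finset.univ) fun (s : Fin N) _ =>
      (hf (ω ^ (r : ℕ) * conj (ω ^ (s : ℕ)))).mul_right (c s)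
    refine hsum.tsum_eq.symm.trans ((tsum_congr fun kl => ?_).trans tsum_zero)
    rcases (hb kl).eq_or_lt with h0 | h0
    · simp [← h0]
    · have key := hω.sum_zpow_pow_eq_zero (hno kl h0)
      calc _ = ∑ s : Fin N, ((b kl : ℂ) * (ω ^ (r : ℕ)) ^ kl.1 * (conj (ω ^ (r : ℕ))) ^ kl.2) *
            (ω ^ (a - ((kl.1 : ℤ) - (kl.2 : ℤ)))) ^ (s : ℕ) := by
            refine Finset.sum_congr rfl fun s _ => ?_
            rw [zpow_sub₀ hω0, zpow_sub₀ hω0, zpow_natCast, zpow_natCast]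
            simp only [hc, map_mul, map_pow, hconj, map_inv₀, inv_inv,
              inv_pow, mul_pow, div_pow, ← pow_mul]
            field_simp
            ring
        _ = 0 := by rw [← Finset.mul_sum, key, mul_zero]
  have := hpos.dotProduct_mulVec_pos hc0
  rw [hker] at this
  simp at this

theorem stmt_15 (f : ℂ → ℂ) (b : ℕ × ℕ → ℝ) (hb : ∀ kl, 0 ≤ b kl)
    (hf : ∀ z : ℂ, HasSum (fun kl : ℕ × ℕ => (b kl : ℂ) * z ^ kl.1 * (conj z) ^ kl.2) (f z))
    (J : Set (ℕ × ℕ)) (hJ : J = {kl | 0 < b kl})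
    (hpd : ∀ (n : ℕ) (z : Fin n → ℂ), Function.Injective z →
      (Matrix.of fun r s : Fin n => f (z r * conj (z s))).PosDef) :
    (0, 0) ∈ J ∧ ∀ p : ℕ, 1 ≤ p → ∀ q : ℕ, q < p →
      {d : ℤ | (∃ kl ∈ J, (kl.1 : ℤ) - (kl.2 : ℤ) = d) ∧ (p : ℤ) ∣ d - (q : ℤ)}.Infinite := by
  subst hJ
  constructor
  · have h0 : f 0 = b (0, 0) := by
      refine (hf 0).unique ?_
      convert hasSum_single (0, 0) ?_ using 1
      · simp
      · rintro ⟨k, l⟩ hkl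
        rcases Nat.eq_zero_or_pos k with rfl | hk
        · have hl : l ≠ 0 := by rintro rfl; exact hkl rfl
          simp [hl]
        · simp [hk.ne']
    have := (hpd 1 (fun _ => 0) (Function.injective_of_subsingleton _)).diag_pos (i := 0)
    simpa [h0] using this
  · intro p hp q hq hfin
    obtain ⟨B, hB⟩ := (hfin.image Int.natAbs).bddAbove
    obtain ⟨kl, hkl, hdvd⟩ := exists_pos_coeff_sub_modEq f b hb hf hpd
      (p * (2 * B + 3)) (by positivity) (q + p * (B + 1))
    set d : ℤ := (kl.1 : ℤ) - (kl.2 : ℤ) with hd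
    have hpd' : (p : ℤ) ∣ d - q := by
      have h1 : (p : ℤ) ∣ q + p * (B + 1) - d :=
        (Dvd.intro _ (by push_cast; rfl)).trans hdvd
      have h2 := (Dvd.intro ((B : ℤ) + 1) rfl : (p : ℤ) ∣ p * (B + 1)).sub h1
      rwa [show (p : ℤ) * (B + 1) - (q + p * (B + 1) - d) = d - q by ring] at h2
    have hdB : d.natAbs ≤ B := hB ⟨d, ⟨⟨kl, hkl, rfl⟩, hpd'⟩, rfl⟩
    have hle : (B : ℤ) + 1 ≤ p * (B + 1) := le_mul_of_one_le_left (by positivity) (by omega)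
    have hmul : ((p * (2 * B + 3) : ℕ) : ℤ) = 2 * (p * (B + 1)) + p := by push_cast; ring
    rw [hmul] at hdvd
    have := Int.le_of_dvd (by omega) hdvd
    omega
end
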